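/- arXiv:1810.08485 — 2 statements merged into one kernel-verified Lean document; each statement's English description precedes it below -/
import Mathlib

section
/- (Meyer Section Theorem) Let B be an element of Λ. For every ε > 0 there exists a Λ-stopping time S such that the graph {(ω, S(ω)) : S(ω) < ∞} is contained in B and P(S < ∞) > P(π(B)) − ε, where π(B) := {ω ∈ Ω : (ω,t) ∈ B for some t ∈ [0,∞)} is the projection of B onto Ω. -/
open MeasureTheory Filter Set Topology
open scoped NNReal ENNReal symmDiff Classical

noncomputable section

namespace Meyer

variable {Ω : Type*}

/-- The σ-field generated by a family of real-valued functions. -/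
def genBy {α : Type*} (C : Set (α → ℝ)) : MeasurableSpace α :=
  ⨆ f ∈ C, MeasurableSpace.comap f inferInstance

/-- A function is càdlàg: right-continuous with left limits. -/
def IsCadlag (f : ℝ≥0 → ℝ) : Prop :=
  (∀ t, Tendsto f (𝓝[≥] t) (𝓝 (f t))) ∧
  ∀ t : ℝ≥0, 0 < t → ∃ l, Tendsto f (𝓝[<] t) (𝓝 l)

/-- A Meyer-σ-field over `(Ω, mΩ)`: a σ-field on `Ω × [0,∞)` contained in the product
σ-field, generated by càdlàg processes, containing `{∅,Ω} × B([0,∞))` and stable under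
stopping at deterministic times. -/
structure IsMeyer (mΩ : MeasurableSpace Ω) (Λ : MeasurableSpace (Ω × ℝ≥0)) : Prop where
  le_prod : Λ ≤ @Prod.instMeasurableSpace Ω ℝ≥0 mΩ inferInstance
  gen_cadlag : ∃ C : Set (Ω × ℝ≥0 → ℝ),
    (∀ Z ∈ C, ∀ ω, IsCadlag fun t => Z (ω, t)) ∧ Λ = genBy C
  contains_borel : ∀ B : Set ℝ≥0, MeasurableSet B → MeasurableSet[Λ] (Set.univ ×ˢ B)
  stop_stable : ∀ Z : Ω × ℝ≥0 → ℝ, Measurable[Λ] Z → ∀ s : ℝ≥0,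
    Measurable[Λ] fun p => Z (p.1, min p.2 s)

/-- A `Λ`-stopping time: `[[S,∞[[ ∈ Λ`. -/
def IsStoppingTimeM (Λ : MeasurableSpace (Ω × ℝ≥0)) (S : Ω → ℝ≥0∞) : Prop :=
  MeasurableSet[Λ] {p : Ω × ℝ≥0 | S p.1 ≤ (p.2 : ℝ≥0∞)}

/-- The associated filtration `F^Λ_t := σ(Z_t : Z Λ-measurable)`. -/
def sigmaAt (Λ : MeasurableSpace (Ω × ℝ≥0)) (t : ℝ≥0) : MeasurableSpace Ω :=
  genBy {f : Ω → ℝ | ∃ Z : Ω × ℝ≥0 → ℝ, Measurable[Λ] Z ∧ f = fun ω => Z (ω, t)}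

/-- `F^Λ_∞`. -/
def sigmaInf (Λ : MeasurableSpace (Ω × ℝ≥0)) : MeasurableSpace Ω := ⨆ t : ℝ≥0, sigmaAt Λ t

/-- A process indexed by `[0,∞]` is `Λ`-measurable if its restriction to `Ω × [0,∞)`
is `Λ`-measurable and its value at `∞` is `F^Λ_∞`-measurable. -/
def MeasurableProcessE (Λ : MeasurableSpace (Ω × ℝ≥0)) (Z : Ω × ℝ≥0∞ → ℝ) : Prop :=
  Measurable[Λ] (fun p : Ω × ℝ≥0 => Z (p.1, (p.2 : ℝ≥0∞))) ∧
  Measurable[sigmaInf Λ] fun ω => Z (ω, ∞)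

/-- `F^Λ_S := σ(Z_S : Z a Λ-measurable process on [0,∞])`. -/
def sigmaAtTime (Λ : MeasurableSpace (Ω × ℝ≥0)) (S : Ω → ℝ≥0∞) : MeasurableSpace Ω :=
  genBy {f : Ω → ℝ | ∃ Z : Ω × ℝ≥0∞ → ℝ, MeasurableProcessE Λ Z ∧ f = fun ω => Z (ω, S ω)}

/-- `S_A`: equal to `S` on `A` and `∞` off `A`. -/
def restrictST (S : Ω → ℝ≥0∞) (A : Set Ω) : Ω → ℝ≥0∞ := fun ω => if ω ∈ A then S ω else ∞

/-- Evaluation of a process indexed by `[0,∞]` at a random time. -/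
def EvalAt (Z : Ω × ℝ≥0∞ → ℝ) (S : Ω → ℝ≥0∞) : Ω → ℝ := fun ω => Z (ω, S ω)

/-- Evaluation of a process indexed by `[0,∞)` at a (finite) random time. -/
def EvalAtF (Z : Ω × ℝ≥0 → ℝ) (S : Ω → ℝ≥0∞) : Ω → ℝ := fun ω => Z (ω, (S ω).toNNReal)

/-- Adaptedness of a process to a raw filtration. -/
def Adapted' (G : ℝ≥0 → MeasurableSpace Ω) (Z : Ω × ℝ≥0 → ℝ) : Prop :=
  ∀ t, Measurable[G t] fun ω => Z (ω, t)

/-- Predictable σ-field of a filtration: generated by continuous adapted processes. -/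
def predSF (G : ℝ≥0 → MeasurableSpace Ω) : MeasurableSpace (Ω × ℝ≥0) :=
  genBy {Z | (∀ ω, Continuous fun t => Z (ω, t)) ∧ Adapted' G Z}

/-- Optional σ-field of a filtration: generated by càdlàg adapted processes. -/
def optSF (G : ℝ≥0 → MeasurableSpace Ω) : MeasurableSpace (Ω × ℝ≥0) :=
  genBy {Z | (∀ ω, IsCadlag fun t => Z (ω, t)) ∧ Adapted' G Z}

/-- Classical stopping time of a raw filtration. -/
def IsStoppingTimeCl (G : ℝ≥0 → MeasurableSpace Ω) (T : Ω → ℝ≥0∞) : Prop :=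
  ∀ t : ℝ≥0, MeasurableSet[G t] {ω | T ω ≤ (t : ℝ≥0∞)}

/-- The right-continuous filtration `F^Λ_{t+}`. -/
def FplusLambda (Λ : MeasurableSpace (Ω × ℝ≥0)) (t : ℝ≥0) : MeasurableSpace Ω :=
  ⨅ (s : ℝ≥0) (_ : t < s), sigmaAt Λ s

/-- Two processes are indistinguishable. -/
def Indistinguishable {τ : Type*} [MeasurableSpace Ω] (P : Measure Ω)
    (X Y : Ω × τ → ℝ) : Prop :=
  P {ω | ∃ t, X (ω, t) ≠ Y (ω, t)} = 0

/-- `Λ` is `P`-complete: every product-measurable process indistinguishable from a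
`Λ`-measurable process is itself `Λ`-measurable. -/
def IsPCompleteM [mΩ : MeasurableSpace Ω] (P : Measure Ω)
    (Λ : MeasurableSpace (Ω × ℝ≥0)) : Prop :=
  ∀ Z Z' : Ω × ℝ≥0 → ℝ, Measurable Z → Measurable[Λ] Z' →
    Indistinguishable P Z Z' → Measurable[Λ] Z

/-- A raw filtration satisfies the usual conditions: monotone, sub-σ-fields of `mΩ`,
right-continuous and `P`-complete. -/
def UsualConditions [mΩ : MeasurableSpace Ω] (P : Measure Ω)
    (G : ℝ≥0 → MeasurableSpace Ω) : Prop :=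
  Monotone G ∧ (∀ t, G t ≤ mΩ) ∧
  (∀ t : ℝ≥0, G t = ⨅ (s : ℝ≥0) (_ : t < s), G s) ∧
  ∀ N : Set Ω, MeasurableSet N → P N = 0 → MeasurableSet[G 0] N

variable [mΩ : MeasurableSpace Ω]

/-- `Λ`-martingale (indexed by `[0,∞]`). -/
def IsMartingaleM (P : Measure Ω) (Λ : MeasurableSpace (Ω × ℝ≥0))
    (Z : Ω × ℝ≥0∞ → ℝ) : Prop :=
  MeasurableProcessE Λ Z ∧
  (∀ S, IsStoppingTimeM Λ S → Integrable (EvalAt Z S) P) ∧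
  ∀ S T : Ω → ℝ≥0∞, IsStoppingTimeM Λ S → IsStoppingTimeM Λ T → S ≤ T →
    EvalAt Z S =ᵐ[P] P[EvalAt Z T|sigmaAtTime Λ S]

/-- `Λ`-supermartingale (indexed by `[0,∞]`). -/
def IsSupermartingaleM (P : Measure Ω) (Λ : MeasurableSpace (Ω × ℝ≥0))
    (Z : Ω × ℝ≥0∞ → ℝ) : Prop :=
  MeasurableProcessE Λ Z ∧
  (∀ S, IsStoppingTimeM Λ S → Integrable (EvalAt Z S) P) ∧
  ∀ S T : Ω → ℝ≥0∞, IsStoppingTimeM Λ S → IsStoppingTimeM Λ T → S ≤ T →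
    P[EvalAt Z T|sigmaAtTime Λ S] ≤ᵐ[P] EvalAt Z S

/-- Class `(D^Λ)` for a process: uniform integrability of `{Z_T : T ∈ S^Λ}`. -/
def ClassD (P : Measure Ω) (Λ : MeasurableSpace (Ω × ℝ≥0)) (Z : Ω × ℝ≥0∞ → ℝ) : Prop :=
  UniformIntegrable (fun S : {S : Ω → ℝ≥0∞ // IsStoppingTimeM Λ S} => EvalAt Z S.1) 1 P

/-- Class `(D^Λ)` for a system. -/
def ClassDSys (P : Measure Ω) (Λ : MeasurableSpace (Ω × ℝ≥0))
    (ZS : (Ω → ℝ≥0∞) → Ω → ℝ) : Prop :=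
  UniformIntegrable (fun S : {S : Ω → ℝ≥0∞ // IsStoppingTimeM Λ S} => ZS S.1) 1 P

/-- `pY` is a `Λ`-projection of `Y` (processes indexed by `[0,∞]`). -/
def IsProjectionE (P : Measure Ω) (Λ : MeasurableSpace (Ω × ℝ≥0))
    (Y pY : Ω × ℝ≥0∞ → ℝ) : Prop :=
  MeasurableProcessE Λ pY ∧
  ∀ S, IsStoppingTimeM Λ S → (∀ ω, S ω < ∞) →
    EvalAt pY S =ᵐ[P] P[EvalAt Y S|sigmaAtTime Λ S]

/-- `pY` is a `Λ`-projection of `Y` (processes indexed by `[0,∞)`). -/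
def IsProjectionF (P : Measure Ω) (Λ : MeasurableSpace (Ω × ℝ≥0))
    (Y pY : Ω × ℝ≥0 → ℝ) : Prop :=
  Measurable[Λ] pY ∧
  ∀ S, IsStoppingTimeM Λ S → (∀ ω, S ω < ∞) →
    EvalAtF pY S =ᵐ[P] P[EvalAtF Y S|sigmaAtTime Λ S]

/-- Right-upper-semicontinuous envelope `Z^*` (with `Z^*_∞ := Z_∞`). -/
def rightLimsup (Z : Ω × ℝ≥0∞ → ℝ) (ω : Ω) (t : ℝ≥0∞) : ℝ :=
  if t = ∞ then Z (ω, ∞)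
  else limsup (fun s : ℝ≥0 => Z (ω, (s : ℝ≥0∞))) (𝓝[>] t.toNNReal)

/-- Right-lower-semicontinuous envelope `Z_*` (with `Z_{∞*} := Z_∞`). -/
def rightLiminf (Z : Ω × ℝ≥0∞ → ℝ) (ω : Ω) (t : ℝ≥0∞) : ℝ :=
  if t = ∞ then Z (ω, ∞)
  else liminf (fun s : ℝ≥0 => Z (ω, (s : ℝ≥0∞))) (𝓝[>] t.toNNReal)

/-- Left-upper-semicontinuous envelope `*Z` (with `*Z_0 := Z_0` and
`*Z_∞ := limsup_{t↑∞} Z_t`). -/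
def leftLimsup (Z : Ω × ℝ≥0∞ → ℝ) (ω : Ω) (t : ℝ≥0∞) : ℝ :=
  if t = 0 then Z (ω, 0)
  else if t = ∞ then limsup (fun s : ℝ≥0 => Z (ω, (s : ℝ≥0∞))) atTop
  else limsup (fun s : ℝ≥0 => Z (ω, (s : ℝ≥0∞))) (𝓝[<] t.toNNReal)

/-- Left-lower-semicontinuous envelope `_*Z`. -/
def leftLiminf (Z : Ω × ℝ≥0∞ → ℝ) (ω : Ω) (t : ℝ≥0∞) : ℝ :=
  if t = 0 then Z (ω, 0)
  else if t = ∞ then liminf (fun s : ℝ≥0 => Z (ω, (s : ℝ≥0∞))) atTop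
  else liminf (fun s : ℝ≥0 => Z (ω, (s : ℝ≥0∞))) (𝓝[<] t.toNNReal)

/-- `T` is `Λ`-accessible. -/
def IsAccessibleM [mΩ2 : MeasurableSpace Ω] (P : Measure Ω)
    (Λ : MeasurableSpace (Ω × ℝ≥0)) (T : Ω → ℝ≥0∞) : Prop :=
  ∃ Tn : ℕ → Ω → ℝ≥0∞, (∀ n, IsStoppingTimeM Λ (Tn n)) ∧
    P (⋃ n, {ω | Tn n ω = T ω ∧ T ω < ∞}) = P {ω | T ω < ∞}

/-- `T` is totally `Λ`-inaccessible. -/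
def IsTotallyInaccessibleM [mΩ2 : MeasurableSpace Ω] (P : Measure Ω)
    (Λ : MeasurableSpace (Ω × ℝ≥0)) (T : Ω → ℝ≥0∞) : Prop :=
  ∀ S, IsStoppingTimeM Λ S → P {ω | S ω = T ω ∧ T ω < ∞} = 0

/-- The σ-field `G_{T-}`: generated by `G_0` and the sets `A ∩ {t < T}`, `A ∈ G_t`. -/
def sigmaPre (G : ℝ≥0 → MeasurableSpace Ω) (T : Ω → ℝ≥0∞) : MeasurableSpace Ω :=
  MeasurableSpace.generateFrom
    ({A | MeasurableSet[G 0] A} ∪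
      {A | ∃ (t : ℝ≥0) (B : Set Ω), MeasurableSet[G t] B ∧ A = B ∩ {ω | (t : ℝ≥0∞) < T ω}})

/-- The σ-field `G_T` of a classical stopping time `T`. -/
def sigmaAtCl (G : ℝ≥0 → MeasurableSpace Ω) (T : Ω → ℝ≥0∞) : MeasurableSpace Ω :=
  MeasurableSpace.generateFrom
    {A | ∀ t : ℝ≥0, MeasurableSet[G t] (A ∩ {ω | T ω ≤ (t : ℝ≥0∞)})}

/-- A divided stopping time `σ = (T, W⁻, W, W⁺)`. -/
structure IsDividedST (Λ : MeasurableSpace (Ω × ℝ≥0)) (T : Ω → ℝ≥0∞)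
    (Wm W Wp : Set Ω) : Prop where
  stopping : IsStoppingTimeCl (FplusLambda Λ) T
  cover : Wm ∪ W ∪ Wp = Set.univ
  disj_mw : Wm ∩ W = ∅
  disj_mp : Wm ∩ Wp = ∅
  disj_wp : W ∩ Wp = ∅
  mem_m : MeasurableSet[sigmaPre (FplusLambda Λ) T] Wm
  m_pos : Wm ∩ {ω | T ω = 0} = ∅
  mem_w : MeasurableSet[sigmaAtTime Λ T] W
  mem_p : MeasurableSet[sigmaAtCl (FplusLambda Λ) T] Wp
  p_fin : Wp ∩ {ω | T ω = ∞} = ∅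
  pred_m : IsStoppingTimeM (predSF (FplusLambda Λ)) (restrictST T Wm)
  st_w : IsStoppingTimeM Λ (restrictST T W)

/-- The value `Z_σ` of a process at a divided stopping time. -/
def divEval (Z : Ω × ℝ≥0∞ → ℝ) (T : Ω → ℝ≥0∞) (Wm W Wp : Set Ω) : Ω → ℝ := fun ω =>
  if ω ∈ Wm then leftLimsup Z ω (T ω)
  else if ω ∈ W then Z (ω, T ω)
  else rightLimsup Z ω (T ω)

/-- `Zb` is the `Λ`-Snell envelope of the system `ZS`: a `Λ`-supermartingale which at
each `Λ`-stopping time `S` is (a version of) `ess sup_{T ∈ S^Λ, T ≥ S} E[Z(T) | F^Λ_S]`. -/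
def IsSnellSys (P : Measure Ω) (Λ : MeasurableSpace (Ω × ℝ≥0))
    (ZS : (Ω → ℝ≥0∞) → Ω → ℝ) (Zb : Ω × ℝ≥0∞ → ℝ) : Prop :=
  IsSupermartingaleM P Λ Zb ∧
  ∀ S, IsStoppingTimeM Λ S →
    (∀ T, IsStoppingTimeM Λ T → S ≤ T →
      P[ZS T|sigmaAtTime Λ S] ≤ᵐ[P] EvalAt Zb S) ∧
    ∀ U : Ω → ℝ,
      (∀ T, IsStoppingTimeM Λ T → S ≤ T → P[ZS T|sigmaAtTime Λ S] ≤ᵐ[P] U) →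
      EvalAt Zb S ≤ᵐ[P] U

/-- `Zb` is the `Λ`-Snell envelope of the process `Z`. -/
def IsSnellProc (P : Measure Ω) (Λ : MeasurableSpace (Ω × ℝ≥0))
    (Z Zb : Ω × ℝ≥0∞ → ℝ) : Prop :=
  IsSnellSys P Λ (fun S => EvalAt Z S) Zb

/-- An `S^Λ`-system. -/
def IsSystemM (P : Measure Ω) (Λ : MeasurableSpace (Ω × ℝ≥0))
    (ZS : (Ω → ℝ≥0∞) → Ω → ℝ) : Prop :=
  (∀ S T, IsStoppingTimeM Λ S → IsStoppingTimeM Λ T →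
    ∀ᵐ ω ∂P, S ω = T ω → ZS S ω = ZS T ω) ∧
  ∀ S, IsStoppingTimeM Λ S → Measurable[sigmaAtTime Λ S] (ZS S)

/-- An `S^Λ`-supermartingale system. -/
def IsSupermartingaleSystem (P : Measure Ω) (Λ : MeasurableSpace (Ω × ℝ≥0))
    (ZS : (Ω → ℝ≥0∞) → Ω → ℝ) : Prop :=
  IsSystemM P Λ ZS ∧ (∀ S, IsStoppingTimeM Λ S → Integrable (ZS S) P) ∧
  ∀ S T, IsStoppingTimeM Λ S → IsStoppingTimeM Λ T → S ≤ T →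
    P[ZS T|sigmaAtTime Λ S] ≤ᵐ[P] ZS S

/-- The process `Zb` aggregates the system `ZS`. -/
def Aggregates (P : Measure Ω) (Λ : MeasurableSpace (Ω × ℝ≥0))
    (Zb : Ω × ℝ≥0∞ → ℝ) (ZS : (Ω → ℝ≥0∞) → Ω → ℝ) : Prop :=
  ∀ S, IsStoppingTimeM Λ S → EvalAt Zb S =ᵐ[P] ZS S

/-- `pY` is the `F`-predictable projection of `Y` (with the convention `(^P Y)_∞ = 0`). -/
def IsPredProjE (P : Measure Ω) (G : ℝ≥0 → MeasurableSpace Ω)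
    (Y pY : Ω × ℝ≥0∞ → ℝ) : Prop :=
  MeasurableProcessE (predSF G) pY ∧ (∀ ω, pY (ω, ∞) = 0) ∧
  ∀ S, IsStoppingTimeM (predSF G) S → (∀ ω, S ω < ∞) →
    EvalAt pY S =ᵐ[P] P[EvalAt Y S|sigmaAtTime (predSF G) S]

section Helpers

/-- Every product-measurable set is a pull-back of a Borel set of a Polish space. -/
lemma exists_rep (B : Set (Ω × ℝ≥0)) (hB : MeasurableSet B) :
    ∃ (φ : Ω → (ℕ → Bool)) (D : Set ((ℕ → Bool) × ℝ≥0)), Measurable φ ∧ MeasurableSet D ∧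
      B = (fun p : Ω × ℝ≥0 => (φ p.1, p.2)) ⁻¹' D := by
  refine MeasurableSpace.induction_on_inter
    (C := fun (B : Set (Ω × ℝ≥0)) _ => ∃ (φ : Ω → (ℕ → Bool)) (D : Set ((ℕ → Bool) × ℝ≥0)),
      Measurable φ ∧ MeasurableSet D ∧ B = (fun p : Ω × ℝ≥0 => (φ p.1, p.2)) ⁻¹' D)
    generateFrom_prod.symm isPiSystem_prod ?_ ?_ ?_ ?_ B hB
  · exact ⟨fun _ _ => false, ∅, measurable_const, MeasurableSet.empty, by simp⟩
  · rintro t ⟨E, hE, F, hF, rfl⟩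
    refine ⟨fun ω _ => decide (ω ∈ E), {x | x.1 0 = true ∧ x.2 ∈ F}, ?_, ?_, ?_⟩
    · refine measurable_pi_lambda _ fun _ => ?_
      refine measurable_to_bool ?_
      have : (fun ω => decide (ω ∈ E)) ⁻¹' {true} = E := by ext; simp
      rw [this]; exact hE
    · have h1 : Measurable fun x : (ℕ → Bool) × ℝ≥0 => x.1 0 :=
        (measurable_pi_apply 0).comp measurable_fst
      exact (h1 (measurableSet_singleton true)).inter (measurable_snd hF)
    · ext p; simp
  · rintro t _ ⟨φ, D, h1, h2, rfl⟩
    exact ⟨φ, Dᶜ, h1, h2.compl, rfl⟩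
  · intro f _ _ h
    choose φ D h1 h2 h3 using h
    refine ⟨fun ω k => φ k.unpair.1 ω k.unpair.2,
      ⋃ n, (fun x : (ℕ → Bool) × ℝ≥0 => ((fun m => x.1 (Nat.pair n m)), x.2)) ⁻¹' D n, ?_, ?_, ?_⟩
    · refine measurable_pi_lambda _ fun k => ?_
      exact (measurable_pi_apply _).comp (h1 _)
    · refine MeasurableSet.iUnion fun n => ?_
      have : Measurable (fun x : (ℕ → Bool) × ℝ≥0 => ((fun m => x.1 (Nat.pair n m)), x.2)) := by
        refine Measurable.prodMk (measurable_pi_lambda _ fun m => ?_) measurable_snd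
        exact (measurable_pi_apply _).comp measurable_fst
      exact this (h2 n)
    · ext p
      simp only [mem_iUnion, mem_preimage, Nat.unpair_pair]
      refine exists_congr fun n => ?_
      rw [h3 n]; rfl

/-- Capacitability of continuous images of the Baire space. -/
lemma exists_compact_image {X : Type*} [TopologicalSpace X] [MeasurableSpace X]
    (ν : Measure X) [ν.OuterRegular] (f : (ℕ → ℕ) → X) (hf : Continuous f)
    (c : ℝ≥0∞) (hc : c < ν (range f)) : ∃ C : Set (ℕ → ℕ), IsCompact C ∧ c ≤ ν (f '' C) := by
  have step : ∀ (k : ℕ) (s : Set (ℕ → ℕ)), c < ν (f '' s) →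
      ∃ m : ℕ, c < ν (f '' (s ∩ {x | x k ≤ m})) := by
    intro k s hs
    have hmono : Monotone fun m : ℕ => f '' (s ∩ {x | x k ≤ m}) := by
      intro a b hab
      refine image_mono (inter_subset_inter_right _ ?_)
      intro x hx; exact le_trans hx hab
    have hU : f '' s = ⋃ m : ℕ, f '' (s ∩ {x | x k ≤ m}) := by
      rw [← image_iUnion, ← inter_iUnion]
      congr 1
      rw [eq_comm, inter_eq_left]
      intro x _
      simp only [mem_iUnion, mem_ofPred_eq]
      exact ⟨x k, le_rfl⟩
    rw [hU, hmono.measure_iUnion] at hs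
    exact lt_iSup_iff.1 hs
  let m : ℕ → Set (ℕ → ℕ) → ℕ := fun k s =>
    if h : ∃ m : ℕ, c < ν (f '' (s ∩ {x | x k ≤ m})) then h.choose else 0
  let s : ℕ → Set (ℕ → ℕ) := fun k => Nat.rec univ (fun k s => s ∩ {x | x k ≤ m k s}) k
  have hs_succ : ∀ k, s (k + 1) = s k ∩ {x | x k ≤ m k (s k)} := fun k => rfl
  have hs : ∀ k, c < ν (f '' s k) := by
    intro k
    induction k with
    | zero => simpa [s] using hc
    | succ k ih =>
      rw [hs_succ]
      have h := step k _ ih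
      have : m k (s k) = h.choose := dif_pos h
      rw [this]
      exact h.choose_spec
  let n : ℕ → ℕ := fun k => m k (s k)
  have hmem : ∀ k x, x ∈ s k → ∀ i < k, x i ≤ n i := by
    intro k
    induction k with
    | zero => intro x _ i hi; omega
    | succ k ih =>
      intro x hx i hi
      rw [hs_succ] at hx
      rcases Nat.lt_succ_iff_lt_or_eq.1 hi with h | h
      · exact ih x hx.1 i h
      · subst h; exact hx.2
  let C : Set (ℕ → ℕ) := Set.pi univ fun i => Iic (n i)
  have hC : IsCompact C := isCompact_univ_pi fun i => (Set.finite_Iic (n i)).isCompact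
  refine ⟨C, hC, ?_⟩
  by_contra! hlt
  obtain ⟨U, hCU, hUo, hU⟩ := Set.exists_isOpen_lt_of_lt _ _ hlt
  have hex : ∀ k, ∃ x, x ∈ s k ∧ f x ∉ U := by
    intro k
    by_contra! h
    have : ν (f '' s k) ≤ ν U := measure_mono (by rintro _ ⟨x, hx, rfl⟩; exact h x hx)
    exact absurd (hs k) (not_lt.2 (this.trans hU.le))
  choose x hx hxU using hex
  have hy : ∀ k, (fun i => min (x k i) (n i)) ∈ C := fun k i _ => mem_Iic.2 (min_le_right _ _)
  obtain ⟨y, hyC, θ, hθ, hlim⟩ := hC.tendsto_subseq hy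
  have hlim2 : Tendsto (fun j => x (θ j)) atTop (𝓝 y) := by
    rw [tendsto_pi_nhds] at hlim ⊢
    intro i
    refine (hlim i).congr' ?_
    filter_upwards [eventually_gt_atTop i] with j hj
    exact min_eq_left (hmem _ _ (hx (θ j)) i (lt_of_lt_of_le hj (hθ.id_le j)))
  have hfy : f y ∈ Uᶜ := hUo.isClosed_compl.mem_of_tendsto ((hf.tendsto y).comp hlim2)
    (Eventually.of_forall fun j => hxU _)
  exact hfy (hCU ⟨y, hyC, rfl⟩)

/-- Measurable section theorem. -/
lemma exists_section (P : Measure Ω) [IsProbabilityMeasure P]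
    (B : Set (Ω × ℝ≥0)) (hB : MeasurableSet B) (δ : ℝ≥0∞) (hδ : 0 < δ) :
    ∃ (A : Set Ω) (R : Ω → ℝ≥0), MeasurableSet A ∧ Measurable R ∧
      (∀ ω ∈ A, (ω, R ω) ∈ B) ∧ P {ω | ∃ t : ℝ≥0, (ω, t) ∈ B} ≤ P A + δ := by
  by_cases hsm : P {ω | ∃ t : ℝ≥0, (ω, t) ∈ B} ≤ δ
  · exact ⟨∅, fun _ => 0, MeasurableSet.empty, measurable_const, by simp, by simpa using hsm⟩
  push Not at hsm
  obtain ⟨φ, D, hφ, hD, rfl⟩ := exists_rep B hB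
  set b := P {ω | ∃ t : ℝ≥0, (ω, t) ∈ (fun p : Ω × ℝ≥0 => (φ p.1, p.2)) ⁻¹' D} with hb
  have : PolishSpace ℝ≥0 := IsClosed.polishSpace (isClosed_Ici (a := (0 : ℝ)))
  have : PolishSpace (ℕ → Bool) := {}
  have : PolishSpace ((ℕ → Bool) × ℝ≥0) := {}
  have hDa : AnalyticSet D := hD.analyticSet
  rw [AnalyticSet] at hDa
  rcases hDa with rfl | ⟨f, hf, rfl⟩
  · simp at hb; rw [hb] at hsm; simp at hsm
  have : IsProbabilityMeasure (P.map φ) := Measure.isProbabilityMeasure_map hφ.aemeasurable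
  have hbν : b ≤ P.map φ (range fun x => (f x).1) := by
    refine le_trans (measure_mono ?_) (Measure.le_map_apply hφ.aemeasurable _)
    rintro ω ⟨t, x, hx⟩
    exact ⟨x, by simp [hx]⟩
  have hb0 : b - δ < b := ENNReal.sub_lt_self (measure_ne_top _ _) (hδ.trans hsm).ne' hδ.ne'
  obtain ⟨C, hC, hcC⟩ := exists_compact_image (P.map φ) (fun x => (f x).1)
    (continuous_fst.comp hf) (b - δ) (lt_of_lt_of_le hb0 hbν)
  have hK : IsCompact (f '' C) := hC.image hf
  set K := f '' C with hKdef
  have hproj : ∀ F : Set ℝ≥0, IsClosed F →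
      MeasurableSet (φ ⁻¹' (Prod.fst '' (K ∩ Prod.snd ⁻¹' F))) := fun F hF =>
    hφ ((hK.inter_right (hF.preimage continuous_snd)).image continuous_fst).isClosed.measurableSet
  have hsec : ∀ x, IsClosed {t : ℝ≥0 | (x, t) ∈ K} := fun x =>
    hK.isClosed.preimage (Continuous.prodMk_right x)
  have hA : MeasurableSet (φ ⁻¹' (Prod.fst '' K)) := by
    simpa using hproj univ isClosed_univ
  have hRmem : ∀ ω ∈ φ ⁻¹' (Prod.fst '' K), (φ ω, sInf {t : ℝ≥0 | (φ ω, t) ∈ K}) ∈ K := by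
    rintro ω ⟨⟨x, t⟩, hx, rfl⟩
    exact (hsec _).csInf_mem ⟨t, hx⟩ (OrderBot.bddBelow _)
  refine ⟨φ ⁻¹' (Prod.fst '' K), fun ω => sInf {t : ℝ≥0 | (φ ω, t) ∈ K}, hA, ?_, ?_, ?_⟩
  · refine measurable_of_Iic fun t => ?_
    have : (fun ω => sInf {t : ℝ≥0 | (φ ω, t) ∈ K}) ⁻¹' Iic t =
        (φ ⁻¹' (Prod.fst '' K))ᶜ ∪ φ ⁻¹' (Prod.fst '' (K ∩ Prod.snd ⁻¹' Iic t)) := by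
      ext ω
      by_cases hω : ω ∈ φ ⁻¹' (Prod.fst '' K)
      · simp only [mem_preimage, mem_Iic, mem_union, mem_compl_iff]
        constructor
        · intro h
          exact Or.inr ⟨_, ⟨hRmem ω hω, h⟩, rfl⟩
        · rintro (h | ⟨⟨x, r⟩, ⟨h1, h2⟩, h3⟩)
          · exact absurd hω h
          · simp only at h3
            subst h3
            exact le_trans (csInf_le (OrderBot.bddBelow _) h1) h2
      · have : {t : ℝ≥0 | (φ ω, t) ∈ K} = ∅ := by
          ext t
          simp only [mem_ofPred_eq, mem_empty_iff_false, iff_false]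
          exact fun h => hω ⟨_, h, rfl⟩
        simp only [mem_preimage, mem_Iic, mem_union, mem_compl_iff, this]
        simp only [NNReal.sInf_empty, zero_le, true_iff]
        exact Or.inl hω
    rw [this]
    exact hA.compl.union (hproj _ isClosed_Iic)
  · intro ω hω
    have := hRmem ω hω
    rw [hKdef] at this
    exact image_subset_range _ _ this
  · have h1 : P (φ ⁻¹' (Prod.fst '' K)) = P.map φ ((fun x => (f x).1) '' C) := by
      rw [Measure.map_apply hφ]
      · rw [hKdef, image_image]
      · have := (hK.image continuous_fst).isClosed.measurableSet
        rwa [hKdef, image_image] at this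
    rw [h1]
    exact tsub_le_iff_right.1 hcC

lemma stop_meas {Λ : MeasurableSpace (Ω × ℝ≥0)} (hΛ : IsMeyer mΩ Λ) (q : ℝ≥0)
    {A : Set (Ω × ℝ≥0)} (hA : MeasurableSet[Λ] A) :
    MeasurableSet[Λ] {p : Ω × ℝ≥0 | (p.1, min p.2 q) ∈ A} := by
  have h1 : Measurable[Λ] (A.indicator fun _ => (1 : ℝ)) :=
    (@measurable_const _ _ _ Λ (1 : ℝ)).indicator hA
  have h2 := hΛ.stop_stable _ h1 q (measurableSet_singleton (1 : ℝ))
  convert h2 using 1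
  ext p
  by_cases h : (p.1, min p.2 q) ∈ A <;> simp [h]

lemma time_meas {Λ : MeasurableSpace (Ω × ℝ≥0)} (hΛ : IsMeyer mΩ Λ) (F : Set ℝ≥0)
    (hF : MeasurableSet F) : MeasurableSet[Λ] {p : Ω × ℝ≥0 | p.2 ∈ F} := by
  convert hΛ.contains_borel F hF using 1
  ext p; simp

lemma exists_st_of_set {Λ : MeasurableSpace (Ω × ℝ≥0)} (W : Set (Ω × ℝ≥0))
    (hW : MeasurableSet[Λ] W) (hup : ∀ ω s t, s ≤ t → (ω, s) ∈ W → (ω, t) ∈ W)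
    (hcl : ∀ ω v, (∀ t, v < t → (ω, t) ∈ W) → (ω, v) ∈ W) :
    ∃ V : Ω → ℝ≥0∞, IsStoppingTimeM Λ V ∧ ∀ ω (t : ℝ≥0), V ω ≤ t ↔ (ω, t) ∈ W := by
  have key : ∀ ω (t : ℝ≥0), (⨅ s : ℝ≥0, ⨅ _ : (ω, s) ∈ W, (s : ℝ≥0∞)) ≤ t ↔ (ω, t) ∈ W := by
    intro ω t
    constructor
    · intro h
      refine hcl ω t fun r hr => ?_
      have h' := lt_of_le_of_lt h (ENNReal.coe_lt_coe.2 hr)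
      simp only [iInf_lt_iff] at h'
      obtain ⟨s, hs, hsr⟩ := h'
      exact hup ω s r (ENNReal.coe_lt_coe.1 hsr).le hs
    · intro h
      exact iInf₂_le t h
  refine ⟨fun ω => ⨅ s : ℝ≥0, ⨅ _ : (ω, s) ∈ W, (s : ℝ≥0∞), ?_, key⟩
  unfold IsStoppingTimeM
  convert hW using 1
  ext ⟨ω, t⟩
  exact key ω t

/-- Sets closed from the right in a `Λ`-measurable manner. -/
def Good (Λ : MeasurableSpace (Ω × ℝ≥0)) (A : Set (Ω × ℝ≥0)) : Prop :=
  ∀ U : Ω → ℝ≥0∞, IsStoppingTimeM Λ U → ∃ V : Ω → ℝ≥0∞, IsStoppingTimeM Λ V ∧ U ≤ V ∧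
    (∀ ω (t : ℝ≥0), (ω, t) ∈ A → U ω ≤ t → V ω ≤ t) ∧
    ∀ ω (t : ℝ≥0), U ω = t → V ω = t → (ω, t) ∈ A

lemma st_iSup {Λ : MeasurableSpace (Ω × ℝ≥0)} (U : ℕ → Ω → ℝ≥0∞)
    (hU : ∀ n, IsStoppingTimeM Λ (U n)) : IsStoppingTimeM Λ (fun ω => ⨆ n, U n ω) := by
  unfold IsStoppingTimeM at *
  convert MeasurableSet.iInter hU using 1
  ext p; simp

lemma st_inf {Λ : MeasurableSpace (Ω × ℝ≥0)} (U V : Ω → ℝ≥0∞)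
    (hU : IsStoppingTimeM Λ U) (hV : IsStoppingTimeM Λ V) :
    IsStoppingTimeM Λ (fun ω => min (U ω) (V ω)) := by
  unfold IsStoppingTimeM at *
  convert MeasurableSet.union hU hV using 1
  ext p; simp

lemma st_top {Λ : MeasurableSpace (Ω × ℝ≥0)} :
    IsStoppingTimeM Λ (fun _ : Ω => (∞ : ℝ≥0∞)) := by
  unfold IsStoppingTimeM
  convert @MeasurableSet.empty _ Λ using 1
  ext p; simp

lemma st_zero {Λ : MeasurableSpace (Ω × ℝ≥0)} :
    IsStoppingTimeM Λ (fun _ : Ω => (0 : ℝ≥0∞)) := by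
  unfold IsStoppingTimeM
  convert @MeasurableSet.univ _ Λ using 1
  ext p; simp

lemma st_measurable {Λ : MeasurableSpace (Ω × ℝ≥0)} (hΛ : IsMeyer mΩ Λ) {U : Ω → ℝ≥0∞}
    (hU : IsStoppingTimeM Λ U) : Measurable U := by
  refine measurable_of_Iic fun x => ?_
  have h : ∀ t : ℝ≥0, MeasurableSet {ω | U ω ≤ t} := fun t =>
    (measurable_prodMk_right (y := t)) (hΛ.le_prod _ hU)
  induction x with
  | top => simp
  | coe t => exact h t

lemma Good.empty {Λ : MeasurableSpace (Ω × ℝ≥0)} : Good Λ ∅ := fun U _ =>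
  ⟨fun _ => ∞, st_top, fun _ => le_top, by simp, by simp⟩

lemma Good.union {Λ : MeasurableSpace (Ω × ℝ≥0)} {A B : Set (Ω × ℝ≥0)} (hA : Good Λ A)
    (hB : Good Λ B) : Good Λ (A ∪ B) := by
  intro U hU
  obtain ⟨V, h1, h2, h3, h4⟩ := hA U hU
  obtain ⟨W, k1, k2, k3, k4⟩ := hB U hU
  refine ⟨fun ω => min (V ω) (W ω), st_inf _ _ h1 k1, fun ω => le_min (h2 ω) (k2 ω), ?_, ?_⟩
  · rintro ω t (h | h) hu
    · exact (min_le_left _ _).trans (h3 ω t h hu)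
    · exact (min_le_right _ _).trans (k3 ω t h hu)
  · intro ω t hu hm
    rcases min_choice (V ω) (W ω) with h | h
    · exact Or.inl (h4 ω t hu (h ▸ hm))
    · exact Or.inr (k4 ω t hu (h ▸ hm))

lemma Good.iInter {Λ : MeasurableSpace (Ω × ℝ≥0)} {A : ℕ → Set (Ω × ℝ≥0)}
    (hA : ∀ n, Good Λ (A n)) : Good Λ (⋂ n, A n) := by
  intro U hU
  choose V h1 h2 h3 h4 using fun n => hA n U hU
  refine ⟨fun ω => ⨆ n, V n ω, st_iSup _ h1, fun ω => le_iSup_of_le 0 (h2 0 ω), ?_, ?_⟩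
  · intro ω t h hu
    exact iSup_le fun n => h3 n ω t (mem_iInter.1 h n) hu
  · intro ω t hu hm
    refine mem_iInter.2 fun n => h4 n ω t hu (le_antisymm ?_ ?_)
    · rw [← hm]; exact le_iSup (fun n => V n ω) n
    · rw [← hu]; exact h2 n ω

lemma Good.biUnion {Λ : MeasurableSpace (Ω × ℝ≥0)} {A : ℕ → Set (Ω × ℝ≥0)}
    (hA : ∀ n, Good Λ (A n)) (N : ℕ) : Good Λ (⋃ n ∈ Finset.range N, A n) := by
  induction N with
  | zero => simpa using Good.empty
  | succ N ih =>
    rw [Finset.range_add_one, Finset.set_biUnion_insert]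
    exact (hA N).union ih

lemma good_ge {Λ : MeasurableSpace (Ω × ℝ≥0)} (hΛ : IsMeyer mΩ Λ) (Z : Ω × ℝ≥0 → ℝ)
    (hZ : Measurable[Λ] Z) (hrc : ∀ ω t, Tendsto (fun s => Z (ω, s)) (𝓝[≥] t) (𝓝 (Z (ω, t))))
    (a : ℝ) : Good Λ {p | a ≤ Z p} := by
  intro U hU
  have hgt : ∀ c : ℝ, MeasurableSet[Λ] {p | c < Z p} := fun c => hZ measurableSet_Ioi
  let W : Set (Ω × ℝ≥0) := {p | U p.1 ≤ p.2 ∧ ∀ n : ℕ, ∃ s : ℝ≥0, U p.1 ≤ s ∧ s ≤ p.2 ∧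
    a - 1 / ((n : ℝ) + 1) < Z (p.1, s)}
  have hWeq : W = {p | U p.1 ≤ p.2} ∩ ⋂ n : ℕ, ({p | a - 1 / ((n : ℝ) + 1) < Z p} ∪
      ⋃ q : ℚ, ({p : Ω × ℝ≥0 | p.2 ∈ Ioi (Real.toNNReal q)} ∩
        {p : Ω × ℝ≥0 | (p.1, min p.2 (Real.toNNReal q)) ∈
          {p | U p.1 ≤ p.2} ∩ {p | a - 1 / ((n : ℝ) + 1) < Z p}})) := by
    ext ⟨ω, t⟩
    simp only [W, mem_ofPred_eq, mem_inter_iff, mem_iInter, mem_union, mem_iUnion, mem_Ioi]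
    refine and_congr_right fun hUt => forall_congr' fun n => ?_
    constructor
    · rintro ⟨s, hs, hst, hz⟩
      rcases hst.eq_or_lt with rfl | hlt
      · exact Or.inl hz
      right
      have h1 : ∀ᶠ r in 𝓝[>] s, a - 1 / ((n : ℝ) + 1) < Z (ω, r) :=
        ((hrc ω s).mono_left (nhdsWithin_mono _ Ioi_subset_Ici_self)).eventually
          (lt_mem_nhds hz)
      obtain ⟨u, hu, hsu⟩ := (mem_nhdsGT_iff_exists_Ioo_subset' hlt).1 h1
      have hlt2 : s < min u t := lt_min hu hlt
      obtain ⟨q, hq1, hq2⟩ := exists_rat_btwn (NNReal.coe_lt_coe.2 hlt2)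
      have hq0 : (0 : ℝ) ≤ q := s.coe_nonneg.trans hq1.le
      have e1 : s < Real.toNNReal q := by
        rw [← NNReal.coe_lt_coe, Real.coe_toNNReal _ hq0]; exact hq1
      have e2 : Real.toNNReal q < min u t := by
        rw [← NNReal.coe_lt_coe, Real.coe_toNNReal _ hq0]; exact hq2
      have e3 := lt_of_lt_of_le e2 (min_le_right _ _)
      refine ⟨q, e3, ?_⟩
      rw [min_eq_right e3.le]
      exact ⟨hs.trans (ENNReal.coe_le_coe.2 e1.le),
        hsu ⟨e1, lt_of_lt_of_le e2 (min_le_left _ _)⟩⟩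
    · rintro (h | ⟨q, h1, h2⟩)
      · exact ⟨t, hUt, le_rfl, h⟩
      · rw [min_eq_right h1.le] at h2
        exact ⟨_, h2.1, h1.le, h2.2⟩
  have hWm : MeasurableSet[Λ] W := by
    rw [hWeq]
    refine MeasurableSet.inter hU (MeasurableSet.iInter fun n => (hgt _).union
      (MeasurableSet.iUnion fun q => (time_meas hΛ _ measurableSet_Ioi).inter
        (stop_meas hΛ _ (MeasurableSet.inter hU (hgt _)))))
  obtain ⟨V, hV, hVW⟩ := exists_st_of_set W hWm
    (by
      rintro ω s t hst ⟨h1, h2⟩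
      refine ⟨h1.trans (ENNReal.coe_le_coe.2 hst), fun n => ?_⟩
      obtain ⟨r, k1, k2, k3⟩ := h2 n
      exact ⟨r, k1, k2.trans hst, k3⟩)
    (by
      intro ω v h
      have hUv : U ω ≤ v := by
        refine le_of_forall_gt_imp_ge_of_dense fun x hx => ?_
        obtain ⟨r, hr1, hr2⟩ := ENNReal.lt_iff_exists_nnreal_btwn.1 hx
        exact (h r (ENNReal.coe_lt_coe.1 hr1)).1.trans hr2.le
      refine ⟨hUv, fun n => ?_⟩
      by_contra! hcon
      have hv := hcon v hUv le_rfl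
      have hn : a - 1 / ((n : ℝ) + 1) < a - 1 / (((n + 1 : ℕ) : ℝ) + 1) := by
        have : 1 / (((n + 1 : ℕ) : ℝ) + 1) < 1 / ((n : ℝ) + 1) := by
          apply one_div_lt_one_div_of_lt
          · positivity
          · push_cast; linarith
        linarith
      have h1 : ∀ᶠ r in 𝓝[≥] v, Z (ω, r) < a - 1 / (((n + 1 : ℕ) : ℝ) + 1) :=
        (hrc ω v).eventually (gt_mem_nhds (lt_of_le_of_lt hv hn))
      obtain ⟨u, hu, hvu⟩ := (mem_nhdsGE_iff_exists_Ico_subset' (lt_add_one v)).1 h1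
      obtain ⟨r, hvr, hru⟩ := exists_between (show v < u from hu)
      obtain ⟨s, k1, k2, k3⟩ := (h r hvr).2 (n + 1)
      rcases le_total s v with hsv | hsv
      · exact absurd (hcon s k1 hsv) (not_le.2 (hn.trans k3))
      · exact absurd (hvu ⟨hsv, lt_of_le_of_lt k2 hru⟩) (not_lt.2 k3.le))
  refine ⟨V, hV, ?_, ?_, ?_⟩
  · intro ω
    by_cases hVt : V ω = ∞
    · rw [hVt]; exact le_top
    · lift V ω to ℝ≥0 using hVt with t ht
      exact ((hVW ω t).1 ht.ge).1
  · intro ω t ht hut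
    refine (hVW ω t).2 ⟨hut, fun n => ⟨t, hut, le_rfl, ?_⟩⟩
    have : (0 : ℝ) < 1 / ((n : ℝ) + 1) := by positivity
    have ht' : a ≤ Z (ω, t) := ht
    linarith
  · intro ω t hu hv
    obtain ⟨-, h⟩ := (hVW ω t).1 hv.le
    change a ≤ Z (ω, t)
    refine le_of_forall_pos_le_add fun ε hε => ?_
    obtain ⟨n, hn⟩ := exists_nat_one_div_lt hε
    obtain ⟨s, k1, k2, k3⟩ := h n
    have : s = t := le_antisymm k2 (ENNReal.coe_le_coe.1 (hu ▸ k1))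
    subst this
    linarith

/-- Inner approximability by good sets. -/
def InnerApprox (Λ : MeasurableSpace (Ω × ℝ≥0)) (μ : Measure (Ω × ℝ≥0))
    (B : Set (Ω × ℝ≥0)) : Prop :=
  ∀ δ : ℝ≥0∞, 0 < δ → ∃ K : Set (Ω × ℝ≥0), K ⊆ B ∧ Good Λ K ∧ MeasurableSet[Λ] K ∧ μ (B \ K) ≤ δ

lemma InnerApprox.of_good {Λ : MeasurableSpace (Ω × ℝ≥0)} {μ : Measure (Ω × ℝ≥0)}
    {B : Set (Ω × ℝ≥0)} (h : Good Λ B) (hm : MeasurableSet B) : InnerApprox Λ μ B :=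
  fun _ _ => ⟨B, Subset.rfl, h, hm, by simp⟩

lemma InnerApprox.iInter {Λ : MeasurableSpace (Ω × ℝ≥0)} {μ : Measure (Ω × ℝ≥0)}
    {B : ℕ → Set (Ω × ℝ≥0)} (h : ∀ n, InnerApprox Λ μ (B n)) : InnerApprox Λ μ (⋂ n, B n) := by
  intro δ hδ
  obtain ⟨d, hd, hsum⟩ := ENNReal.exists_pos_sum_of_countable' hδ.ne' ℕ
  choose K k1 k2 k3 k4 using fun n => h n (d n) (hd n)
  refine ⟨⋂ n, K n, iInter_mono k1, Good.iInter k2, MeasurableSet.iInter k3, ?_⟩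
  have : (⋂ n, B n) \ ⋂ n, K n ⊆ ⋃ n, (B n \ K n) := by
    rintro x ⟨h1, h2⟩
    simp only [mem_iInter, not_forall] at h1 h2
    obtain ⟨n, hn⟩ := h2
    exact mem_iUnion.2 ⟨n, h1 n, hn⟩
  calc μ _ ≤ μ (⋃ n, (B n \ K n)) := measure_mono this
    _ ≤ ∑' n, μ (B n \ K n) := measure_iUnion_le _
    _ ≤ ∑' n, d n := ENNReal.tsum_le_tsum k4
    _ ≤ δ := hsum.le

lemma InnerApprox.iUnion {Λ : MeasurableSpace (Ω × ℝ≥0)} {μ : Measure (Ω × ℝ≥0)}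
    [IsFiniteMeasure μ]
    {B : ℕ → Set (Ω × ℝ≥0)} (h : ∀ n, InnerApprox Λ μ (B n)) : InnerApprox Λ μ (⋃ n, B n) := by
  intro δ hδ
  have hδ2 : 0 < δ / 2 := ENNReal.half_pos hδ.ne'
  obtain ⟨d, hd, hsum⟩ := ENNReal.exists_pos_sum_of_countable' hδ2.ne' ℕ
  choose K k1 k2 k3 k4 using fun n => h n (d n) (hd n)
  let L : ℕ → Set (Ω × ℝ≥0) := fun N => ⋃ n ∈ Finset.range N, K n
  have hLm : ∀ N, MeasurableSet (L N) := fun N =>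
    Finset.measurableSet_biUnion _ fun n _ => k3 n
  have hLmono : Monotone L := by
    intro a b hab
    exact biUnion_subset_biUnion_left fun n hn =>
      Finset.mem_coe.2 (Finset.mem_range.2 ((Finset.mem_range.1 hn).trans_le hab))
  have hlim : Tendsto (fun N => μ ((⋃ n, K n) \ L N)) atTop (𝓝 0) := by
    have h1 := tendsto_measure_iInter_atTop (μ := μ) (s := fun N => (⋃ n, K n) \ L N)
      (fun N => ((MeasurableSet.iUnion k3).diff (hLm N)).nullMeasurableSet)
      (fun a b hab => diff_subset_diff_right (hLmono hab)) ⟨0, measure_ne_top _ _⟩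
    have h2 : (⋂ N, (⋃ n, K n) \ L N) = ∅ := by
      ext x
      simp only [mem_iInter, mem_empty_iff_false, iff_false, not_forall]
      by_cases hx : x ∈ ⋃ n, K n
      · obtain ⟨n, hn⟩ := mem_iUnion.1 hx
        exact ⟨n + 1, fun hx' => hx'.2 (mem_biUnion (by simp) hn)⟩
      · exact ⟨0, fun hx' => hx hx'.1⟩
    rwa [h2, measure_empty] at h1
  obtain ⟨N, hN⟩ := (hlim.eventually (gt_mem_nhds hδ2)).exists
  refine ⟨L N, ?_, Good.biUnion k2 N, hLm N, ?_⟩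
  · exact iUnion₂_subset fun n _ => (k1 n).trans (subset_iUnion B n)
  have : (⋃ n, B n) \ L N ⊆ (⋃ n, (B n \ K n)) ∪ ((⋃ n, K n) \ L N) := by
    rintro x ⟨h1, h2⟩
    obtain ⟨n, hn⟩ := mem_iUnion.1 h1
    by_cases hx : x ∈ K n
    · exact Or.inr ⟨mem_iUnion.2 ⟨n, hx⟩, h2⟩
    · exact Or.inl (mem_iUnion.2 ⟨n, hn, hx⟩)
  calc μ _ ≤ μ ((⋃ n, (B n \ K n)) ∪ ((⋃ n, K n) \ L N)) := measure_mono this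
    _ ≤ μ (⋃ n, (B n \ K n)) + μ ((⋃ n, K n) \ L N) := measure_union_le _ _
    _ ≤ (∑' n, d n) + δ / 2 :=
      add_le_add ((measure_iUnion_le _).trans (ENNReal.tsum_le_tsum k4)) hN.le
    _ ≤ δ / 2 + δ / 2 := by gcongr
    _ = δ := ENNReal.add_halves δ

lemma innerApprox_all {Λ : MeasurableSpace (Ω × ℝ≥0)} (hΛ : IsMeyer mΩ Λ)
    (μ : Measure (Ω × ℝ≥0)) [IsFiniteMeasure μ] (B : Set (Ω × ℝ≥0)) (hB : MeasurableSet[Λ] B) :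
    InnerApprox Λ μ B := by
  let M : MeasurableSpace (Ω × ℝ≥0) :=
    { MeasurableSet' := fun B => InnerApprox Λ μ B ∧ InnerApprox Λ μ Bᶜ
      measurableSet_empty := by
        refine ⟨InnerApprox.of_good Good.empty MeasurableSet.empty, ?_⟩
        rw [compl_empty]
        refine InnerApprox.of_good ?_ MeasurableSet.univ
        exact fun U hU => ⟨U, hU, le_rfl, fun _ _ _ h => h, fun _ _ _ _ => mem_univ _⟩
      measurableSet_compl := fun s hs => ⟨hs.2, by rw [compl_compl]; exact hs.1⟩
      measurableSet_iUnion := fun f hf => ⟨InnerApprox.iUnion fun n => (hf n).1, by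
        rw [compl_iUnion]; exact InnerApprox.iInter fun n => (hf n).2⟩ }
  obtain ⟨C, hC, hgen⟩ := hΛ.gen_cadlag
  have hle : Λ ≤ M := by
    rw [hgen]
    refine iSup₂_le fun Z hZ => ?_
    have hZm : Measurable[Λ] Z := by
      rw [hgen]
      exact measurable_iff_comap_le.2 (le_iSup₂_of_le Z hZ le_rfl)
    rw [← measurable_iff_comap_le]
    refine measurable_of_Ici fun a => ?_
    refine ⟨InnerApprox.of_good (good_ge hΛ Z hZm (fun ω t => (hC Z hZ ω).1 t) a)
      (hZm measurableSet_Ici), ?_⟩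
    have heq : (Z ⁻¹' Ici a)ᶜ = ⋃ n : ℕ, {p | -(a - 1 / ((n : ℝ) + 1)) ≤ -Z p} := by
      ext p
      simp only [mem_compl_iff, mem_preimage, mem_Ici, not_le, mem_iUnion, mem_ofPred_eq,
        neg_le_neg_iff]
      constructor
      · intro h
        obtain ⟨n, hn⟩ := exists_nat_one_div_lt (sub_pos.2 h)
        exact ⟨n, by linarith⟩
      · rintro ⟨n, hn⟩
        have : (0 : ℝ) < 1 / ((n : ℝ) + 1) := by positivity
        linarith
    rw [heq]
    refine InnerApprox.iUnion fun n => InnerApprox.of_good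
      (good_ge hΛ (fun p => -Z p) hZm.neg (fun ω t => ((hC Z hZ ω).1 t).neg) _) ?_
    exact hZm.neg measurableSet_Ici
  exact (hle B hB).1

lemma st_restrict {Λ : MeasurableSpace (Ω × ℝ≥0)} (hΛ : IsMeyer mΩ Λ) {U V : Ω → ℝ≥0∞}
    (hU : IsStoppingTimeM Λ U) (hV : IsStoppingTimeM Λ V) (hUV : U ≤ V) :
    IsStoppingTimeM Λ (fun ω => if U ω = V ω then U ω else ∞) := by
  unfold IsStoppingTimeM
  have heq : {p : Ω × ℝ≥0 | (if U p.1 = V p.1 then U p.1 else ∞) ≤ (p.2 : ℝ≥0∞)} =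
      {p | V p.1 ≤ p.2} \ ⋃ q : ℚ, ({p : Ω × ℝ≥0 | p.2 ∈ Ici (Real.toNNReal q)} ∩
        {p : Ω × ℝ≥0 | (p.1, min p.2 (Real.toNNReal q)) ∈ {p | U p.1 ≤ p.2} \ {p | V p.1 ≤ p.2}}) := by
    ext ⟨ω, t⟩
    simp only [mem_ofPred_eq, Set.mem_sdiff, mem_iUnion, mem_inter_iff, mem_Ici, not_exists, not_and,
      not_not]
    constructor
    · intro h
      by_cases hEq : U ω = V ω
      · rw [if_pos hEq] at h
        refine ⟨hEq ▸ h, fun q hq hu => hEq ▸ hu⟩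
      · rw [if_neg hEq] at h
        simp at h
    · rintro ⟨h1, h2⟩
      by_cases hEq : U ω = V ω
      · rw [if_pos hEq, hEq]; exact h1
      · exfalso
        have hlt : U ω < V ω := lt_of_le_of_ne (hUV ω) hEq
        obtain ⟨q, -, hq1, hq2⟩ := ENNReal.lt_iff_exists_rat_btwn.1 hlt
        have hqt : Real.toNNReal q ≤ t := ENNReal.coe_le_coe.1 (hq2.le.trans h1)
        have := h2 q hqt
        rw [min_eq_right hqt] at this
        exact absurd (this hq1.le) (not_le.2 hq2)
  rw [heq]
  exact MeasurableSet.diff hV (MeasurableSet.iUnion fun q =>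
    (time_meas hΛ _ measurableSet_Ici).inter (stop_meas hΛ _ (MeasurableSet.diff hU hV)))

lemma exists_st_good (P : Measure Ω) [IsProbabilityMeasure P]
    {Λ : MeasurableSpace (Ω × ℝ≥0)} (hΛ : IsMeyer mΩ Λ) (K : Set (Ω × ℝ≥0)) (hK : Good Λ K)
    (A : Set Ω) (R : Ω → ℝ≥0) (hR : ∀ ω ∈ A, (ω, R ω) ∈ K) :
    ∃ S : Ω → ℝ≥0∞, IsStoppingTimeM Λ S ∧ (∀ ω (t : ℝ≥0), S ω = t → (ω, t) ∈ K) ∧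
      P A ≤ P {ω | S ω < ∞} := by
  let 𝒰 : Set (Ω → ℝ≥0∞) := {U | IsStoppingTimeM Λ U ∧ ∀ ω ∈ A, U ω ≤ R ω}
  let I : (Ω → ℝ≥0∞) → ℝ≥0∞ := fun U => ∫⁻ ω, (1 + U ω)⁻¹ ∂P
  have hne : (I '' 𝒰).Nonempty := ⟨_, _, ⟨st_zero, fun ω _ => by simp⟩, rfl⟩
  obtain ⟨u, -, hu, hmem⟩ := exists_seq_tendsto_sInf hne (OrderBot.bddBelow _)
  choose U hU hUu using hmem
  let Us : Ω → ℝ≥0∞ := fun ω => ⨆ n, U n ω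
  have hUs : Us ∈ 𝒰 := ⟨st_iSup _ fun n => (hU n).1, fun ω hω => iSup_le fun n => (hU n).2 ω hω⟩
  have hImono : ∀ X Y : Ω → ℝ≥0∞, X ≤ Y → I Y ≤ I X := fun X Y h =>
    lintegral_mono fun ω => ENNReal.inv_le_inv.2 (add_le_add_right (h ω) 1)
  have hmin : I Us ≤ sInf (I '' 𝒰) := by
    refine ge_of_tendsto' hu fun n => ?_
    rw [← hUu n]
    exact hImono _ _ fun ω => le_iSup (fun n => U n ω) n
  obtain ⟨V, v1, v2, v3, v4⟩ := hK Us hUs.1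
  have hV : V ∈ 𝒰 := ⟨v1, fun ω hω => v3 ω _ (hR ω hω) (hUs.2 ω hω)⟩
  have hIV : I Us ≤ I V := hmin.trans (sInf_le ⟨V, hV, rfl⟩)
  have hfin : I V ≠ ∞ := by
    refine ne_top_of_le_ne_top ENNReal.one_ne_top ?_
    calc I V ≤ ∫⁻ _, 1 ∂P := lintegral_mono fun ω => by
          rw [ENNReal.inv_le_one]; exact le_self_add
      _ = 1 := by simp
  have hae : (fun ω => (1 + V ω)⁻¹) =ᵐ[P] fun ω => (1 + Us ω)⁻¹ := by
    refine ae_eq_of_ae_le_of_lintegral_le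
      (Eventually.of_forall fun ω => ENNReal.inv_le_inv.2 (add_le_add_right (v2 ω) 1)) hfin ?_ hIV
    exact ((measurable_const.add (st_measurable hΛ hUs.1)).inv).aemeasurable
  refine ⟨fun ω => if Us ω = V ω then Us ω else ∞, st_restrict hΛ hUs.1 v1 v2, ?_, ?_⟩
  · intro ω t h
    change (if Us ω = V ω then Us ω else ∞) = t at h
    by_cases hEq : Us ω = V ω
    · rw [if_pos hEq] at h
      exact v4 ω t h (hEq ▸ h)
    · rw [if_neg hEq] at h
      simp at h
  · refine measure_mono_ae ?_
    filter_upwards [hae] with ω hω hωA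
    have hEq : Us ω = V ω := ((ENNReal.add_right_inj ENNReal.one_ne_top).1
      (inv_injective hω)).symm
    change (if Us ω = V ω then Us ω else ∞) < ∞
    rw [if_pos hEq]
    exact lt_of_le_of_lt (hUs.2 ω hωA) ENNReal.coe_lt_top

lemma measurable_pair {R : Ω → ℝ≥0} (hR : Measurable R) : Measurable fun ω => (ω, R ω) :=
  measurable_id.prodMk hR

end Helpers

/-- **Meyer Section Theorem.** -/
theorem statement1 (P : Measure Ω) [IsProbabilityMeasure P] [hPc : P.IsComplete]
    (Λ : MeasurableSpace (Ω × ℝ≥0)) (hΛ : IsMeyer mΩ Λ)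
    (B : Set (Ω × ℝ≥0)) (hB : MeasurableSet[Λ] B) (ε : ℝ≥0∞) (hε : 0 < ε) :
    ∃ S : Ω → ℝ≥0∞, IsStoppingTimeM Λ S ∧
      (∀ ω (t : ℝ≥0), S ω = (t : ℝ≥0∞) → (ω, t) ∈ B) ∧
      P {ω | ∃ t : ℝ≥0, (ω, t) ∈ B} < P {ω | S ω < ∞} + ε := by
  set δ := min ε 1 / 3 with hδdef
  have hm0 : min ε 1 ≠ 0 := (lt_min hε one_pos).ne'
  have hmt : min ε 1 ≠ ∞ := ne_top_of_le_ne_top ENNReal.one_ne_top (min_le_right _ _)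
  have hδ : 0 < δ := ENNReal.div_pos hm0 (by simp)
  obtain ⟨A, R, hA, hR, hRB, hPA⟩ := exists_section P B (hΛ.le_prod _ hB) δ hδ
  have hg : Measurable[mΩ, Λ] fun ω => (ω, R ω) :=
    (measurable_pair hR).mono le_rfl hΛ.le_prod
  obtain ⟨K, hKB, hKg, hKm, hKμ⟩ := innerApprox_all hΛ
    ((P.restrict A).map fun ω => (ω, R ω)) B hB δ hδ
  have hBK : MeasurableSet[Λ] (B \ K) := hB.diff hKm
  rw [Measure.map_apply hg hBK, Measure.restrict_apply (hg hBK)] at hKμ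
  obtain ⟨S, hS, hSK, hSP⟩ := exists_st_good P hΛ K hKg (A ∩ {ω | (ω, R ω) ∈ K}) R
    (fun ω hω => hω.2)
  refine ⟨S, hS, fun ω t h => hKB (hSK ω t h), ?_⟩
  have hsub : A ⊆ (A ∩ {ω | (ω, R ω) ∈ K}) ∪ ((fun ω => (ω, R ω)) ⁻¹' (B \ K) ∩ A) := by
    intro ω hω
    by_cases h : (ω, R ω) ∈ K
    · exact Or.inl ⟨hω, h⟩
    · exact Or.inr ⟨⟨hRB ω hω, h⟩, hω⟩
  have hA2 : P A ≤ P {ω | S ω < ∞} + δ :=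
    (measure_mono hsub).trans ((measure_union_le _ _).trans (add_le_add hSP hKμ))
  have hlt : δ + δ < ε := by
    refine lt_of_lt_of_le ?_ (min_le_left ε 1)
    have hδt : δ ≠ ∞ := (ENNReal.div_lt_top hmt (by simp)).ne
    calc δ + δ < δ + δ + δ := ENNReal.lt_add_right (by simp [hδt]) hδ.ne'
      _ = min ε 1 := ENNReal.add_thirds _
  calc P {ω | ∃ t : ℝ≥0, (ω, t) ∈ B} ≤ P {ω | S ω < ∞} + δ + δ :=
        hPA.trans (add_le_add hA2 le_rfl)
    _ = P {ω | S ω < ∞} + (δ + δ) := add_assoc _ _ _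
    _ < P {ω | S ω < ∞} + ε := ENNReal.add_lt_add_left (measure_ne_top _ _) hlt

end Meyer
end
end

section
/- Let Λ be P-complete and let F = (F_t) be a filtration satisfying the usual conditions with P(F) ⊂ Λ ⊂ O(F). A càdlàg process X is Λ-measurable if and only if: (i) for every finite Λ-stopping time T, X_T is F^Λ_T-measurable, and (ii) for every totally Λ-inaccessible F-stopping time T, the jump ΔX_T := X_T − X_{T−} vanishes a.s. -/
open MeasureTheory Filter Set Topology
open scoped NNReal ENNReal symmDiff Classical

noncomputable section

namespace Meyer

variable {Ω : Type*}

variable [mΩ : MeasurableSpace Ω]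

/-! ### Deterministic part: first big increment after a given time -/

def dq (n : ℕ) : ℝ≥0 := TopologicalSpace.denseSeq ℝ≥0 n

lemma dq_between {a b : ℝ≥0} (h : a < b) : ∃ n, a < dq n ∧ dq n < b := by
  obtain ⟨c, hc, h1, h2⟩ := (TopologicalSpace.denseRange_denseSeq ℝ≥0).exists_between h
  obtain ⟨n, rfl⟩ := hc
  exact ⟨n, h1, h2⟩

/-- Times after `q` at which `f` has moved by more than `e` from `f q`. -/
def hitSet (f : ℝ≥0 → ℝ) (q e : ℝ≥0) : Set ℝ≥0 := {t | q < t ∧ (e : ℝ) < |f t - f q|}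

/-- The first hitting time. -/
def hitT (f : ℝ≥0 → ℝ) (q e : ℝ≥0) : ℝ≥0∞ := ⨅ t ∈ hitSet f q e, (t : ℝ≥0∞)

/-- The hitting time if attained, and infinity otherwise. -/
def attT (f : ℝ≥0 → ℝ) (q e : ℝ≥0) : ℝ≥0∞ :=
  if ∃ t ∈ hitSet f q e, hitT f q e = (t : ℝ≥0∞) then hitT f q e else ∞

lemma hitT_le {f : ℝ≥0 → ℝ} {q e t : ℝ≥0} (h : t ∈ hitSet f q e) :
    hitT f q e ≤ (t : ℝ≥0∞) := iInf₂_le t h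

lemma hitT_lt_iff {f : ℝ≥0 → ℝ} (hf : IsCadlag f) (q e r : ℝ≥0) :
    hitT f q e < (r : ℝ≥0∞) ↔ ∃ n, dq n < r ∧ q < dq n ∧ (e : ℝ) < |f (dq n) - f q| := by
  constructor
  · intro h
    simp only [hitT, iInf_lt_iff] at h
    obtain ⟨t, ⟨h1, h2⟩, h3⟩ := h
    have h3 : t < r := by exact_mod_cast h3
    have hev : ∀ᶠ s in 𝓝[≥] t, (e : ℝ) < |f s - f q| :=
      ((hf.1 t).sub_const (f q)).abs.eventually (lt_mem_nhds h2)
    have hev' : ∀ᶠ s in 𝓝[>] t, (e : ℝ) < |f s - f q| :=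
      hev.filter_mono (nhdsWithin_mono _ Ioi_subset_Ici_self)
    obtain ⟨u, hu, hu'⟩ := (mem_nhdsGT_iff_exists_Ioo_subset' h3).1 hev'
    obtain ⟨n, hn1, hn2⟩ := dq_between (lt_min hu h3)
    exact ⟨n, hn2.trans_le (min_le_right _ _), h1.trans hn1,
      hu' ⟨hn1, hn2.trans_le (min_le_left _ _)⟩⟩
  · rintro ⟨n, h1, h2, h3⟩
    exact (hitT_le ⟨h2, h3⟩).trans_lt (by exact_mod_cast h1)

lemma attT_lt_iff {f : ℝ≥0 → ℝ} (hf : IsCadlag f) (q e r : ℝ≥0) :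
    attT f q e < (r : ℝ≥0∞) ↔ ∃ n, dq n < r ∧ hitT f q e < (dq n : ℝ≥0∞) ∧
      ∃ k : ℕ, ∀ m, dq m < dq n → hitT f q e < (dq m : ℝ≥0∞) →
        (e : ℝ) + 1 / ((k : ℝ) + 1) ≤ |f (dq m) - f q| := by
  constructor
  · intro h
    unfold attT at h
    split_ifs at h with hc
    · obtain ⟨t, ⟨h1, h2⟩, h3⟩ := hc
      rw [h3] at h
      have h4 : t < r := by exact_mod_cast h
      obtain ⟨k, hk⟩ := exists_nat_one_div_lt (sub_pos.2 h2)
      have h2' : (e : ℝ) + 1 / ((k : ℝ) + 1) < |f t - f q| := by linarith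
      have hev : ∀ᶠ s in 𝓝[≥] t, (e : ℝ) + 1 / ((k : ℝ) + 1) < |f s - f q| :=
        ((hf.1 t).sub_const (f q)).abs.eventually (lt_mem_nhds h2')
      have hev' := hev.filter_mono (nhdsWithin_mono _ (Ioi_subset_Ici_self (a := t)))
      obtain ⟨u, hu, hu'⟩ := (mem_nhdsGT_iff_exists_Ioo_subset' h4).1 hev'
      obtain ⟨n, hn1, hn2⟩ := dq_between (lt_min hu h4)
      refine ⟨n, hn2.trans_le (min_le_right _ _), ?_, k, fun m hm1 hm2 => ?_⟩
      · rw [h3]; exact_mod_cast hn1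
      · rw [h3] at hm2
        have hm2 : t < dq m := by exact_mod_cast hm2
        exact le_of_lt (hu' ⟨hm2, (hm1.trans hn2).trans_le (min_le_left _ _)⟩)
    · exact absurd h (by simp)
  · rintro ⟨n, h1, h2, k, h3⟩
    obtain ⟨t, ht⟩ : ∃ t : ℝ≥0, hitT f q e = (t : ℝ≥0∞) :=
      ⟨(hitT f q e).toNNReal, (ENNReal.coe_toNNReal h2.ne_top).symm⟩
    have htn : t < dq n := by rw [ht] at h2; exact_mod_cast h2
    have hbig : (e : ℝ) + 1 / ((k : ℝ) + 1) ≤ |f t - f q| := by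
      by_contra hlt
      push Not at hlt
      have hev : ∀ᶠ s in 𝓝[≥] t, |f s - f q| < (e : ℝ) + 1 / ((k : ℝ) + 1) :=
        ((hf.1 t).sub_const (f q)).abs.eventually (gt_mem_nhds hlt)
      have hev' := hev.filter_mono (nhdsWithin_mono _ (Ioi_subset_Ici_self (a := t)))
      obtain ⟨u, hu, hu'⟩ := (mem_nhdsGT_iff_exists_Ioo_subset' htn).1 hev'
      obtain ⟨m, hm1, hm2⟩ := dq_between (lt_min hu htn)
      have := h3 m (hm2.trans_le (min_le_right _ _)) (by rw [ht]; exact_mod_cast hm1)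
      have h5 : |f (dq m) - f q| < (e : ℝ) + 1 / ((k : ℝ) + 1) :=
        hu' ⟨hm1, hm2.trans_le (min_le_left _ _)⟩
      linarith
    have hpos : (0 : ℝ) < 1 / ((k : ℝ) + 1) := by positivity
    have hqt : q ≤ t := by
      have : (q : ℝ≥0∞) ≤ hitT f q e :=
        le_iInf₂ fun s hs => by exact_mod_cast hs.1.le
      rw [ht] at this; exact_mod_cast this
    have hqt' : q < t := by
      refine lt_of_le_of_ne hqt ?_
      rintro rfl
      have : (0 : ℝ) ≤ e := e.2
      simp at hbig
      have : (0 : ℝ) < ((k : ℝ) + 1)⁻¹ := by positivity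
      linarith
    have hmem : t ∈ hitSet f q e := ⟨hqt', by linarith⟩
    have : attT f q e = t := by
      unfold attT
      rw [if_pos ⟨t, hmem, ht⟩, ht]
    rw [this]
    exact_mod_cast htn.trans h1

lemma attT_eq_coe_iff {f : ℝ≥0 → ℝ} {q e t : ℝ≥0} :
    attT f q e = (t : ℝ≥0∞) ↔ t ∈ hitSet f q e ∧ (t : ℝ≥0∞) ≤ hitT f q e := by
  constructor
  · intro h
    unfold attT at h
    split_ifs at h with hc
    · obtain ⟨s, hs, h3⟩ := hc
      have : s = t := by rw [h3] at h; exact_mod_cast h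
      subst this
      exact ⟨hs, h.ge⟩
    · exact absurd h (by simp)
  · rintro ⟨h1, h2⟩
    have : hitT f q e = t := le_antisymm (hitT_le h1) h2
    unfold attT
    rw [if_pos ⟨t, h1, this⟩, this]

lemma jump_cover {f : ℝ≥0 → ℝ} (hf : IsCadlag f) {t : ℝ≥0}
    (hj : ¬ Tendsto f (𝓝[<] t) (𝓝 (f t))) :
    ∃ i j : ℕ, attT f (dq i) (dq j) = (t : ℝ≥0∞) := by
  have ht : 0 < t := by
    rcases eq_or_ne t 0 with rfl | h
    · exfalso; apply hj
      have : 𝓝[<] (0 : ℝ≥0) = ⊥ := by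
        have : Iio (0 : ℝ≥0) = ∅ := by ext x; simp
        rw [this, nhdsWithin_empty]
      rw [this]; exact tendsto_bot
    · exact pos_iff_ne_zero.2 h
  obtain ⟨l, hl⟩ := hf.2 t ht
  have hne : f t ≠ l := fun h => hj (h ▸ hl)
  have hd : 0 < |f t - l| := abs_pos.2 (sub_ne_zero.2 hne)
  set d := |f t - l| with hd_def
  have hev : ∀ᶠ s in 𝓝[<] t, |f s - l| < d / 4 := by
    have := (hl.sub_const l).abs
    rw [sub_self, abs_zero] at this
    exact this.eventually (gt_mem_nhds (by positivity))
  obtain ⟨u, hu, hu'⟩ := (mem_nhdsLT_iff_exists_Ioo_subset' ht).1 hev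
  obtain ⟨i, hi1, hi2⟩ := dq_between hu
  obtain ⟨j, hj1, hj2⟩ := dq_between (a := (d / 2).toNNReal) (b := (3 * d / 4).toNNReal)
    ((Real.toNNReal_lt_toNNReal_iff (by positivity)).2 (by linarith))
  have hj1 : d / 2 < dq j := (Real.toNNReal_lt_iff_lt_coe (by positivity)).1 hj1
  have hj2 : (dq j : ℝ) < 3 * d / 4 := by
    rw [Real.lt_toNNReal_iff_coe_lt] at hj2; exact hj2
  have hq : |f (dq i) - l| < d / 4 := hu' ⟨hi1, hi2⟩
  refine ⟨i, j, attT_eq_coe_iff.2 ⟨⟨hi2, ?_⟩, le_iInf₂ fun s hs => ?_⟩⟩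
  · have : d ≤ |f t - f (dq i)| + |f (dq i) - l| := abs_sub_le _ _ _
    linarith
  · by_contra hst
    have hst : s < t := by exact_mod_cast not_le.1 hst
    have h1 : |f s - l| < d / 4 := hu' ⟨hi1.trans hs.1, hst⟩
    have h2 : |f s - f (dq i)| ≤ |f s - l| + |l - f (dq i)| := abs_sub_le _ _ _
    rw [abs_sub_comm l] at h2
    have h3 := hs.2
    linarith

/-! ### Measurability part -/

lemma measurable_genBy {α : Type*} {C : Set (α → ℝ)} {f : α → ℝ} (h : f ∈ C) :
    Measurable[genBy C] f := by
  have : MeasurableSpace.comap f inferInstance ≤ genBy C :=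
    le_iSup₂ (f := fun (f : α → ℝ) (_ : f ∈ C) => MeasurableSpace.comap f inferInstance) f h
  exact Measurable.mono (comap_measurable f) this le_rfl

lemma genBy_le {α : Type*} {C : Set (α → ℝ)} {m : MeasurableSpace α}
    (h : ∀ f ∈ C, Measurable[m] f) : genBy C ≤ m :=
  iSup₂_le fun f hf => (h f hf).comap_le

lemma measurable_section {Ω : Type*} {G : ℝ≥0 → MeasurableSpace Ω} (t : ℝ≥0) :
    @Measurable Ω (Ω × ℝ≥0) (G t) (optSF G) (fun ω => (ω, t)) := by
  rw [measurable_iff_le_map]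
  refine genBy_le fun f hf => ?_
  intro s hs
  exact hf.2 t hs

lemma stop_cl {Ω : Type*} {G : ℝ≥0 → MeasurableSpace Ω} {Λ : MeasurableSpace (Ω × ℝ≥0)}
    (h2 : Λ ≤ optSF G) {S : Ω → ℝ≥0∞} (hS : IsStoppingTimeM Λ S) : IsStoppingTimeCl G S :=
  fun t => measurable_section (G := G) t (h2 _ hS)

/-- `T ∧ t` is `G_t`-measurable. -/
lemma min_meas {Ω : Type*} {G : ℝ≥0 → MeasurableSpace Ω} (hmono : Monotone G)
    {T : Ω → ℝ≥0∞} (hT : IsStoppingTimeCl G T) (t : ℝ≥0) :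
    Measurable[G t] fun ω => min (T ω) (t : ℝ≥0∞) := by
  let _ := G t
  refine measurable_of_Iic fun x => ?_
  rcases le_or_gt (t : ℝ≥0∞) x with h | h
  · have : (fun ω => min (T ω) (t : ℝ≥0∞)) ⁻¹' Iic x = univ := by
      ext ω; simp [h]
    rw [this]; exact MeasurableSet.univ
  · obtain ⟨y, rfl⟩ : ∃ y : ℝ≥0, x = y := ⟨x.toNNReal, (ENNReal.coe_toNNReal h.ne_top).symm⟩
    have : (fun ω => min (T ω) (t : ℝ≥0∞)) ⁻¹' Iic (y : ℝ≥0∞) = {ω | T ω ≤ y} := by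
      ext ω; simp [not_le.2 (ENNReal.coe_lt_coe.1 h)]
    rw [this]
    exact hmono (ENNReal.coe_lt_coe.1 h).le _ (hT y)

/-- The open stochastic interval after a stopping time is predictable. -/
lemma pred_Ioi {Ω : Type*} {G : ℝ≥0 → MeasurableSpace Ω} (hmono : Monotone G)
    {T : Ω → ℝ≥0∞} (hT : IsStoppingTimeCl G T) :
    MeasurableSet[predSF G] {p : Ω × ℝ≥0 | T p.1 < (p.2 : ℝ≥0∞)} := by
  set Z : Ω × ℝ≥0 → ℝ := fun p => (p.2 : ℝ) - (min (T p.1) (p.2 : ℝ≥0∞)).toReal with hZ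
  have hZm : Measurable[predSF G] Z := by
    refine measurable_genBy ⟨fun ω => ?_, fun t => ?_⟩
    · refine NNReal.continuous_coe.sub ?_
      have hc : Continuous fun t : ℝ≥0 => min (T ω) (t : ℝ≥0∞) :=
        continuous_const.min ENNReal.continuous_coe
      refine ENNReal.continuousOn_toReal.comp_continuous hc fun t => ?_
      exact ((min_le_right _ _).trans_lt ENNReal.coe_lt_top).ne
    · have hm := min_meas hmono hT t
      let _ := G t
      exact hm.ennreal_toReal.const_sub (t : ℝ)
  have : {p : Ω × ℝ≥0 | T p.1 < (p.2 : ℝ≥0∞)} = Z ⁻¹' Ioi 0 := by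
    ext ⟨ω, t⟩
    simp only [mem_ofPred_eq, mem_preimage, mem_Ioi, hZ, sub_pos]
    rw [show ((t : ℝ) = (t : ℝ≥0∞).toReal) from rfl,
      ENNReal.toReal_lt_toReal ((min_le_right _ _).trans_lt ENNReal.coe_lt_top).ne
        ENNReal.coe_ne_top]
    simp
  rw [this]
  exact hZm measurableSet_Ioi

/-- `A × (q, ∞)` is predictable for `A ∈ G_q`. -/
lemma pred_rect {Ω : Type*} {G : ℝ≥0 → MeasurableSpace Ω} (hmono : Monotone G)
    {q : ℝ≥0} {A : Set Ω} (hA : MeasurableSet[G q] A) :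
    MeasurableSet[predSF G] {p : Ω × ℝ≥0 | p.1 ∈ A ∧ q < p.2} := by
  have hT : IsStoppingTimeCl G (restrictST (fun _ => (q : ℝ≥0∞)) A) := by
    intro t
    rcases le_or_gt q t with h | h
    · have : {ω | restrictST (fun _ => (q : ℝ≥0∞)) A ω ≤ (t : ℝ≥0∞)} = A := by
        ext ω
        by_cases hω : ω ∈ A <;> simp [restrictST, hω, h]
      rw [this]; exact hmono h _ hA
    · have : {ω | restrictST (fun _ => (q : ℝ≥0∞)) A ω ≤ (t : ℝ≥0∞)} = ∅ := by
        ext ω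
        by_cases hω : ω ∈ A <;> simp [restrictST, hω, h]
      rw [this]; exact @MeasurableSet.empty _ (G t)
  have := pred_Ioi hmono hT
  convert this using 1
  ext ⟨ω, t⟩
  by_cases hω : ω ∈ A <;> simp [restrictST, hω]

/-- Reduction by right-continuity. -/
lemma stop_of_lt {Ω : Type*} {G : ℝ≥0 → MeasurableSpace Ω} (hmono : Monotone G)
    (hrc : ∀ t : ℝ≥0, G t = ⨅ (s : ℝ≥0) (_ : t < s), G s) {T : Ω → ℝ≥0∞}
    (h : ∀ t : ℝ≥0, MeasurableSet[G t] {ω | T ω < (t : ℝ≥0∞)}) : IsStoppingTimeCl G T := by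
  intro t
  rw [hrc t]
  simp only [MeasurableSpace.measurableSet_iInf]
  intro s hs
  have : {ω | T ω ≤ (t : ℝ≥0∞)} =
      ⋂ n : ℕ, ⋂ (_ : t < dq n ∧ dq n < s), {ω | T ω < (dq n : ℝ≥0∞)} := by
    ext ω
    simp only [mem_ofPred_eq, mem_iInter]
    constructor
    · intro h n hn
      exact h.trans_lt (by exact_mod_cast hn.1)
    · intro h
      by_contra hlt
      push Not at hlt
      obtain ⟨u, hu1, hu2⟩ := ENNReal.lt_iff_exists_nnreal_btwn.1 hlt
      have hu1 : t < u := by exact_mod_cast hu1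
      obtain ⟨n, hn1, hn2⟩ := dq_between (lt_min hu1 hs)
      have h3 := h n ⟨hn1, hn2.trans_le (min_le_right _ _)⟩
      have h4 : (dq n : ℝ≥0∞) < u := by exact_mod_cast hn2.trans_le (min_le_left _ _)
      exact absurd (h3.trans (h4.trans hu2)) (lt_irrefl _)
  rw [this]
  exact MeasurableSet.iInter fun n => MeasurableSet.iInter fun hn => hmono hn.2.le _ (h _)

section adapted

variable {Ω : Type*} {G : ℝ≥0 → MeasurableSpace Ω} {X : Ω × ℝ≥0 → ℝ}

lemma hit_lt_meas (hmono : Monotone G) (hXc : ∀ ω, IsCadlag fun t => X (ω, t))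
    (hXa : Adapted' G X) (q e r : ℝ≥0) :
    MeasurableSet[G r] {ω | hitT (fun t => X (ω, t)) q e < (r : ℝ≥0∞)} := by
  simp only [hitT_lt_iff (hXc _)]
  have : {ω | ∃ n, dq n < r ∧ q < dq n ∧ (e : ℝ) < |X (ω, dq n) - X (ω, q)|} =
      ⋃ n : ℕ, ⋃ (_ : dq n < r ∧ q < dq n), {ω | (e : ℝ) < |X (ω, dq n) - X (ω, q)|} := by
    ext ω; simp [and_assoc]
  rw [this]
  refine MeasurableSet.iUnion fun n => MeasurableSet.iUnion fun hn => ?_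
  have h1 : Measurable[G r] fun ω => X (ω, dq n) := (hXa _).mono (hmono hn.1.le) le_rfl
  have h2 : Measurable[G r] fun ω => X (ω, q) :=
    (hXa _).mono (hmono (hn.2.trans hn.1).le) le_rfl
  let _ := G r
  exact measurableSet_lt measurable_const (h1.sub h2).abs

lemma hit_isStopping (hmono : Monotone G) (hrc : ∀ t : ℝ≥0, G t = ⨅ (s : ℝ≥0) (_ : t < s), G s)
    (hXc : ∀ ω, IsCadlag fun t => X (ω, t)) (hXa : Adapted' G X) (q e : ℝ≥0) :
    IsStoppingTimeCl G fun ω => hitT (fun t => X (ω, t)) q e :=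
  stop_of_lt hmono hrc fun t => hit_lt_meas hmono hXc hXa q e t

lemma att_isStopping (hmono : Monotone G) (hrc : ∀ t : ℝ≥0, G t = ⨅ (s : ℝ≥0) (_ : t < s), G s)
    (hXc : ∀ ω, IsCadlag fun t => X (ω, t)) (hXa : Adapted' G X) (q e : ℝ≥0) :
    IsStoppingTimeCl G fun ω => attT (fun t => X (ω, t)) q e := by
  refine stop_of_lt hmono hrc fun r => ?_
  simp only [attT_lt_iff (hXc _)]
  have : {ω | ∃ n, dq n < r ∧ hitT (fun t => X (ω, t)) q e < (dq n : ℝ≥0∞) ∧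
      ∃ k : ℕ, ∀ m, dq m < dq n → hitT (fun t => X (ω, t)) q e < (dq m : ℝ≥0∞) →
        (e : ℝ) + 1 / ((k : ℝ) + 1) ≤ |X (ω, dq m) - X (ω, q)|} =
      ⋃ n : ℕ, ⋃ (_ : dq n < r), ({ω | hitT (fun t => X (ω, t)) q e < (dq n : ℝ≥0∞)} ∩
        ⋃ k : ℕ, ⋂ m : ℕ, ⋂ (_ : dq m < dq n),
          ({ω | hitT (fun t => X (ω, t)) q e < (dq m : ℝ≥0∞)}ᶜ ∪
            (if q < dq m then {ω | (e : ℝ) + 1 / ((k : ℝ) + 1) ≤ |X (ω, dq m) - X (ω, q)|}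
              else ∅))) := by
    ext ω
    simp only [mem_ofPred_eq, mem_iUnion, mem_inter_iff, mem_iInter, mem_union, mem_compl_iff,
      exists_prop]
    refine exists_congr fun n => and_congr_right fun _ => and_congr_right fun _ =>
      exists_congr fun k => forall_congr' fun m => forall_congr' fun _ => ?_
    rw [imp_iff_not_or]
    by_cases hq : q < dq m
    · rw [if_pos hq]; rfl
    · rw [if_neg hq]
      have : ¬ hitT (fun t => X (ω, t)) q e < (dq m : ℝ≥0∞) := by
        rw [not_lt]
        refine le_iInf₂ fun s hs => ?_
        exact_mod_cast (not_lt.1 hq).trans hs.1.le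
      simp [this]
  rw [this]
  refine MeasurableSet.iUnion fun n => MeasurableSet.iUnion fun hn => ?_
  refine MeasurableSet.inter (hmono hn.le _ (hit_lt_meas hmono hXc hXa q e _)) ?_
  refine MeasurableSet.iUnion fun k => MeasurableSet.iInter fun m =>
    MeasurableSet.iInter fun hm => ?_
  have hmr := (hm.trans hn).le
  refine MeasurableSet.union (hmono hmr _ (hit_lt_meas hmono hXc hXa q e _)).compl ?_
  split_ifs with hq
  · have h1 : Measurable[G r] fun ω => X (ω, dq m) := (hXa _).mono (hmono hmr) le_rfl
    have h2 : Measurable[G r] fun ω => X (ω, q) :=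
      (hXa _).mono (hmono (hq.le.trans hmr)) le_rfl
    let _ := G r
    exact measurableSet_le measurable_const (h1.sub h2).abs
  · exact @MeasurableSet.empty _ (G r)

/-- `X_q 1_{(q,∞)}` is predictable. -/
lemma pred_const (hmono : Monotone G) (hXa : Adapted' G X) (q : ℝ≥0) :
    Measurable[predSF G] fun p : Ω × ℝ≥0 => if q < p.2 then X (p.1, q) else 0 := by
  intro B hB
  have hI : MeasurableSet[predSF G] {p : Ω × ℝ≥0 | q < p.2} := by
    have := pred_rect hmono (q := q) (A := univ) MeasurableSet.univ
    simpa using this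
  have hA := pred_rect hmono (q := q) (A := (fun ω => X (ω, q)) ⁻¹' B) (hXa q hB)
  have : (fun p : Ω × ℝ≥0 => if q < p.2 then X (p.1, q) else 0) ⁻¹' B =
      {p : Ω × ℝ≥0 | p.1 ∈ (fun ω => X (ω, q)) ⁻¹' B ∧ q < p.2} ∪
        ({p : Ω × ℝ≥0 | q < p.2}ᶜ ∩ {_p | (0 : ℝ) ∈ B}) := by
    ext p
    by_cases h : q < p.2 <;> simp [h]
  rw [this]
  exact hA.union (hI.compl.inter (MeasurableSet.const _))

/-- If `X` is `Λ`-measurable, the attained hitting times are `Λ`-stopping times. -/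
lemma att_stopM {Λ : MeasurableSpace (Ω × ℝ≥0)} (hmono : Monotone G)
    (hrc : ∀ t : ℝ≥0, G t = ⨅ (s : ℝ≥0) (_ : t < s), G s) (h1 : predSF G ≤ Λ)
    (hXc : ∀ ω, IsCadlag fun t => X (ω, t)) (hXa : Adapted' G X)
    (hX : Measurable[Λ] X) (q e : ℝ≥0) :
    IsStoppingTimeM Λ fun ω => attT (fun t => X (ω, t)) q e := by
  unfold IsStoppingTimeM
  have hI : MeasurableSet[Λ] {p : Ω × ℝ≥0 | q < p.2} := by
    have := pred_rect hmono (q := q) (A := univ) MeasurableSet.univ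
    exact h1 _ (by simpa using this)
  have hq : Measurable[Λ] fun p : Ω × ℝ≥0 => if q < p.2 then X (p.1, q) else 0 :=
    (pred_const hmono hXa q).mono h1 le_rfl
  have hE : MeasurableSet[Λ] {p : Ω × ℝ≥0 |
      (e : ℝ) < |X p - (if q < p.2 then X (p.1, q) else 0)|} := by
    let _ := Λ
    exact measurableSet_lt measurable_const (hX.sub hq).abs
  have hgt := h1 _ (pred_Ioi hmono (att_isStopping hmono hrc hXc hXa q e))
  have hhit := h1 _ (pred_Ioi hmono (hit_isStopping hmono hrc hXc hXa q e))
  have : {p : Ω × ℝ≥0 | attT (fun t => X (p.1, t)) q e ≤ (p.2 : ℝ≥0∞)} =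
      {p : Ω × ℝ≥0 | attT (fun t => X (p.1, t)) q e < (p.2 : ℝ≥0∞)} ∪
      (({p : Ω × ℝ≥0 | q < p.2} ∩ {p : Ω × ℝ≥0 |
        (e : ℝ) < |X p - (if q < p.2 then X (p.1, q) else 0)|}) ∩
        {p : Ω × ℝ≥0 | hitT (fun t => X (p.1, t)) q e < (p.2 : ℝ≥0∞)}ᶜ) := by
    ext ⟨ω, t⟩
    simp only [mem_ofPred_eq, mem_union, mem_inter_iff, mem_compl_iff, le_iff_lt_or_eq,
      attT_eq_coe_iff, hitSet, not_lt]
    refine or_congr_right ?_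
    by_cases h : q < t <;> simp [h]
  rw [this]
  exact hgt.union ((hI.inter hE).inter hhit.compl)

end adapted

/-! ### Evaluation at finite stopping times, left limits -/

section eval

variable {Ω : Type*} {Λ : MeasurableSpace (Ω × ℝ≥0)}

lemma exists_eval {T : Ω → ℝ≥0∞} (hfin : ∀ ω, T ω < ∞) {f : Ω → ℝ}
    (hf : Measurable[sigmaAtTime Λ T] f) :
    ∃ Z : Ω × ℝ≥0 → ℝ, Measurable[Λ] Z ∧ ∀ ω, f ω = Z (ω, (T ω).toNNReal) := by
  have hle : sigmaAtTime Λ T ≤ Λ.comap fun ω => (ω, (T ω).toNNReal) := by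
    refine genBy_le ?_
    rintro _ ⟨Z, hZ, rfl⟩
    have h := hZ.1.comp (comap_measurable (m := Λ) fun ω => (ω, (T ω).toNNReal))
    have he : (fun ω => Z (ω, T ω)) =
        (fun p : Ω × ℝ≥0 => Z (p.1, (p.2 : ℝ≥0∞))) ∘ fun ω => (ω, (T ω).toNNReal) := by
      funext ω
      simp [ENNReal.coe_toNNReal (hfin ω).ne]
    rw [he]; exact h
  obtain ⟨Z, hZ, h⟩ := (hf.mono hle le_rfl).exists_eq_measurable_comp
  exact ⟨Z, hZ, fun ω => congrFun h ω⟩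

lemma eval_meas {X : Ω × ℝ≥0 → ℝ} (hX : Measurable[Λ] X) {T : Ω → ℝ≥0∞}
    (hfin : ∀ ω, T ω < ∞) : Measurable[sigmaAtTime Λ T] (EvalAtF X T) := by
  refine measurable_genBy ⟨fun p => if p.2 = ∞ then 0 else X (p.1, p.2.toNNReal), ⟨?_, ?_⟩, ?_⟩
  · simpa using hX
  · simp
  · funext ω
    simp [EvalAtF, (hfin ω).ne]

lemma graph_meas {G : ℝ≥0 → MeasurableSpace Ω} (hmono : Monotone G) (h1 : predSF G ≤ Λ)
    (h2 : Λ ≤ optSF G) {S : Ω → ℝ≥0∞} (hS : IsStoppingTimeM Λ S) :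
    MeasurableSet[Λ] {p : Ω × ℝ≥0 | S p.1 = (p.2 : ℝ≥0∞)} := by
  have h := h1 _ (pred_Ioi hmono (stop_cl h2 hS))
  have : {p : Ω × ℝ≥0 | S p.1 = (p.2 : ℝ≥0∞)} = {p : Ω × ℝ≥0 | S p.1 ≤ (p.2 : ℝ≥0∞)} \
      {p : Ω × ℝ≥0 | S p.1 < (p.2 : ℝ≥0∞)} := by
    ext p
    simp only [mem_ofPred_eq, Set.mem_sdiff, not_lt]
    exact le_antisymm_iff
  rw [this]
  exact MeasurableSet.diff hS h

lemma graph_inter_meas {G : ℝ≥0 → MeasurableSpace Ω} (hmono : Monotone G) (h1 : predSF G ≤ Λ)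
    (h2 : Λ ≤ optSF G) {S : Ω → ℝ≥0∞} (hS : IsStoppingTimeM Λ S) (hfin : ∀ ω, S ω < ∞)
    {X : Ω × ℝ≥0 → ℝ} (hX : Measurable[sigmaAtTime Λ S] (EvalAtF X S))
    {B : Set ℝ} (hB : MeasurableSet B) :
    MeasurableSet[Λ] ({p : Ω × ℝ≥0 | S p.1 = (p.2 : ℝ≥0∞)} ∩ X ⁻¹' B) := by
  obtain ⟨Z, hZ, h⟩ := exists_eval hfin hX
  have : {p : Ω × ℝ≥0 | S p.1 = (p.2 : ℝ≥0∞)} ∩ X ⁻¹' B =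
      {p : Ω × ℝ≥0 | S p.1 = (p.2 : ℝ≥0∞)} ∩ Z ⁻¹' B := by
    ext ⟨ω, t⟩
    simp only [mem_inter_iff, mem_ofPred_eq, mem_preimage]
    refine and_congr_right fun hω => ?_
    have h3 := h ω
    simp only [EvalAtF, hω, ENNReal.toNNReal_coe] at h3
    rw [h3]
  rw [this]
  exact (graph_meas hmono h1 h2 hS).inter (hZ hB)

/-- Dyadic-type approximation strictly from the left. -/
def gl (n : ℕ) (k : ℕ) : ℝ≥0 := (k : ℝ≥0) / ((n : ℝ≥0) + 1)

def kl (n : ℕ) (t : ℝ≥0) : ℕ := ⌈t * ((n : ℝ≥0) + 1)⌉₊ - 1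

lemma kl_lt (n : ℕ) {t : ℝ≥0} (ht : 0 < t) : gl n (kl n t) < t := by
  have hpos : (0 : ℝ≥0) < (n : ℝ≥0) + 1 := by positivity
  unfold gl kl
  rw [div_lt_iff₀ hpos]
  have hc : 0 < ⌈t * ((n : ℝ≥0) + 1)⌉₊ := Nat.ceil_pos.2 (by positivity)
  exact Nat.lt_ceil.1 (Nat.sub_lt hc one_pos)

lemma le_kl (n : ℕ) (t : ℝ≥0) : (t : ℝ) - 1 / ((n : ℝ) + 1) ≤ gl n (kl n t) := by
  have hpos : (0 : ℝ) < (n : ℝ) + 1 := by positivity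
  have h1 : t * ((n : ℝ≥0) + 1) ≤ (kl n t : ℝ≥0) + 1 := by
    refine (Nat.le_ceil _).trans ?_
    unfold kl
    have : ∀ a : ℕ, a ≤ a - 1 + 1 := fun a => by omega
    exact_mod_cast this _
  have h1 : (t : ℝ) * ((n : ℝ) + 1) ≤ (kl n t : ℝ) + 1 := by exact_mod_cast h1
  unfold gl
  push_cast
  rw [le_div_iff₀ hpos, sub_mul, div_mul_cancel₀ _ hpos.ne']
  linarith

lemma kl_tendsto {t : ℝ≥0} (ht : 0 < t) :
    Tendsto (fun n => gl n (kl n t)) atTop (𝓝[<] t) := by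
  refine tendsto_nhdsWithin_iff.2 ⟨?_, Eventually.of_forall fun n => kl_lt n ht⟩
  rw [← NNReal.tendsto_coe]
  have h0 : Tendsto (fun n : ℕ => (t : ℝ) - 1 / ((n : ℝ) + 1)) atTop (𝓝 t) := by
    simpa using (tendsto_one_div_add_atTop_nhds_zero_nat (𝕜 := ℝ)).const_sub (t : ℝ)
  exact tendsto_of_tendsto_of_tendsto_of_le_of_le h0 tendsto_const_nhds (fun n => le_kl n t)
    fun n => by exact_mod_cast (kl_lt n ht).le

lemma leftY_meas {α : Type*} {m : MeasurableSpace α} {F : ℕ → ℕ → α → ℝ}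
    (hF : ∀ n k, Measurable (F n k)) {κ : ℕ → α → ℕ} (hκ : ∀ n, Measurable (κ n)) {Y : α → ℝ}
    (hY : ∀ p, Tendsto (fun n => F n (κ n p) p) atTop (𝓝 (Y p))) : Measurable Y := by
  refine measurable_of_tendsto_metrizable (f := fun n p => F n (κ n p) p) (fun n => ?_)
    (tendsto_pi_nhds.2 hY)
  have h : Measurable fun x : ℕ × α => F n x.1 x.2 :=
    measurable_from_prod_countable_right fun k => hF n k
  exact h.comp ((hκ n).prodMk measurable_id)

lemma exists_left {G : ℝ≥0 → MeasurableSpace Ω} (hmono : Monotone G) (h1 : predSF G ≤ Λ)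
    (hB : ∀ B : Set ℝ≥0, MeasurableSet B → MeasurableSet[Λ] (Set.univ ×ˢ B : Set (Ω × ℝ≥0)))
    {X : Ω × ℝ≥0 → ℝ} (hXc : ∀ ω, IsCadlag fun t => X (ω, t)) (hXa : Adapted' G X) :
    ∃ Y : Ω × ℝ≥0 → ℝ, Measurable[Λ] Y ∧
      ∀ ω t, 0 < t → Tendsto (fun s => X (ω, s)) (𝓝[<] t) (𝓝 (Y (ω, t))) := by
  have hex : ∀ p : Ω × ℝ≥0, ∃ l, (0 < p.2 → Tendsto (fun s => X (p.1, s)) (𝓝[<] p.2) (𝓝 l)) ∧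
      (p.2 = 0 → l = 0) := by
    rintro ⟨ω, t⟩
    rcases eq_or_ne t 0 with h | h
    · exact ⟨0, fun h' => absurd h h'.ne', fun _ => rfl⟩
    · obtain ⟨l, hl⟩ := (hXc ω).2 t (pos_iff_ne_zero.2 h)
      exact ⟨l, fun _ => hl, fun h' => absurd h' h⟩
  choose Y hY hY0 using hex
  refine ⟨Y, ?_, fun ω t ht => hY (ω, t) ht⟩
  have hsnd : Measurable[Λ] (Prod.snd : Ω × ℝ≥0 → ℝ≥0) := by
    intro B hBm
    have := hB B hBm
    convert this using 1
    ext p; simp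
  have hk : ∀ n, Measurable[Λ] fun p : Ω × ℝ≥0 => kl n p.2 := by
    intro n
    have : Measurable (kl n) := by
      unfold kl
      exact (measurable_from_top (f := fun m : ℕ => m - 1)).comp
        (Nat.measurable_ceil.comp (measurable_id.mul_const _))
    exact this.comp hsnd
  refine leftY_meas (fun n k => (pred_const hmono hXa (gl n k)).mono h1 le_rfl) hk ?_
  rintro ⟨ω, t⟩
  rcases eq_or_ne t 0 with h | h
  · have h0 : Y (ω, t) = 0 := hY0 (ω, t) h
    rw [h0]
    subst h
    simp
  · have ht : 0 < t := pos_iff_ne_zero.2 h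
    refine ((hY (ω, t) ht).comp (kl_tendsto ht)).congr fun n => ?_
    simp [kl_lt n ht]

end eval

/-! ### Decomposition into accessible and totally inaccessible parts -/

section decomp

variable {Ω : Type*} [mΩ : MeasurableSpace Ω] {Λ : MeasurableSpace (Ω × ℝ≥0)}

lemma stop_meas_s5 {G : ℝ≥0 → MeasurableSpace Ω} (hle : ∀ t, G t ≤ mΩ) {T : Ω → ℝ≥0∞}
    (hT : IsStoppingTimeCl G T) : Measurable T := by
  refine measurable_of_Iic fun x => ?_
  rcases eq_or_ne x ∞ with rfl | h
  · simp
  · obtain ⟨y, rfl⟩ : ∃ y : ℝ≥0, x = y := ⟨x.toNNReal, (ENNReal.coe_toNNReal h).symm⟩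
    exact hle y _ (hT y)

/-- Existence of a maximising countable family. -/
lemma exists_max (P : Measure Ω) [IsProbabilityMeasure P] {ι : Type*} [Nonempty ι]
    (A : ι → Set Ω) (hA : ∀ i, MeasurableSet (A i)) :
    ∃ s : ℕ → ι, ∀ i, P (A i \ ⋃ n, A (s n)) = 0 := by
  obtain ⟨u, -, hu, hmem⟩ := exists_seq_tendsto_sSup
    (S := Set.range fun s : ℕ → ι => P (⋃ n, A (s n))) (Set.range_nonempty _) (OrderTop.bddAbove _)
  choose v hv using hmem
  let s : ℕ → ι := fun n => v n.unpair.1 n.unpair.2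
  have hsup : ∀ w : ℕ → ι, P (⋃ n, A (w n)) ≤ P (⋃ n, A (s n)) := by
    intro w
    refine (le_sSup (Set.mem_range_self w)).trans (le_of_tendsto' hu fun n => ?_)
    rw [← hv n]
    refine measure_mono (iUnion_subset fun m => ?_)
    refine subset_iUnion_of_subset (Nat.pair n m) ?_
    simp [s]
  refine ⟨s, fun i => ?_⟩
  let w : ℕ → ι := fun n => Nat.casesOn n i s
  have hw : (⋃ n, A (s n)) ∪ (A i \ ⋃ n, A (s n)) ⊆ ⋃ n, A (w n) := by
    rintro x (hx | hx)
    · obtain ⟨n, hn⟩ := mem_iUnion.1 hx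
      exact mem_iUnion.2 ⟨n + 1, hn⟩
    · exact mem_iUnion.2 ⟨0, hx.1⟩
  have hm := (measure_mono (μ := P) hw).trans (hsup w)
  have hU : MeasurableSet (⋃ n, A (s n)) := MeasurableSet.iUnion fun n => hA _
  rw [measure_union disjoint_sdiff_right ((hA i).diff hU)] at hm
  have hfin : P (⋃ n, A (s n)) ≠ ∞ := measure_ne_top _ _
  have h0 : P (⋃ n, A (s n)) + P (A i \ ⋃ n, A (s n)) ≤ P (⋃ n, A (s n)) + 0 := by simpa using hm
  exact le_antisymm ((ENNReal.add_le_add_iff_left hfin).1 h0) zero_le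

lemma decomp (P : Measure Ω) [IsProbabilityMeasure P] {G : ℝ≥0 → MeasurableSpace Ω}
    (hmono : Monotone G) (hle : ∀ t, G t ≤ mΩ) (h2 : Λ ≤ optSF G) {T : Ω → ℝ≥0∞}
    (hT : IsStoppingTimeCl G T) :
    ∃ S : ℕ → Ω → ℝ≥0∞, (∀ n, IsStoppingTimeM Λ (S n)) ∧
      IsStoppingTimeCl G (restrictST T {ω | ∀ n, S n ω ≠ T ω}) ∧
      IsTotallyInaccessibleM P Λ (restrictST T {ω | ∀ n, S n ω ≠ T ω}) := by
  have : Nonempty {S : Ω → ℝ≥0∞ // IsStoppingTimeM Λ S} := by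
    refine ⟨⟨fun _ => 0, ?_⟩⟩
    unfold IsStoppingTimeM
    simp
  have hTm := stop_meas_s5 hle hT
  obtain ⟨s, hs⟩ := exists_max P (ι := {S : Ω → ℝ≥0∞ // IsStoppingTimeM Λ S})
    (fun S => {ω | S.1 ω = T ω ∧ T ω < ∞}) (fun S =>
      (measurableSet_eq_fun (stop_meas_s5 hle (stop_cl h2 S.2)) hTm).inter
        (measurableSet_lt hTm measurable_const))
  refine ⟨fun n => (s n).1, fun n => (s n).2, ?_, ?_⟩
  · intro t
    have : {ω | restrictST T {ω | ∀ n, (s n).1 ω ≠ T ω} ω ≤ (t : ℝ≥0∞)} =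
        {ω | T ω ≤ t} ∩ ⋂ n, ({ω | (s n).1 ω ≤ t} ∩
          {ω | min ((s n).1 ω) (t : ℝ≥0∞) = min (T ω) (t : ℝ≥0∞)})ᶜ := by
      ext ω
      simp only [restrictST, mem_ofPred_eq, mem_inter_iff, mem_iInter, mem_compl_iff, not_and]
      by_cases hTt : T ω ≤ t
      · simp only [hTt, true_and, min_eq_left]
        split_ifs with hc
        · simp only [hTt, true_iff]
          intro n hn
          rw [min_eq_left hn]; exact hc n
        · simp only [top_le_iff, ENNReal.coe_ne_top, false_iff]
          push Not at hc ⊢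
          obtain ⟨n, hn⟩ := hc
          exact ⟨n, hn ▸ hTt, by rw [hn, min_eq_left hTt]⟩
      · simp only [hTt, false_and, iff_false]
        split_ifs
        · exact hTt
        · simp
    rw [this]
    have hmT := min_meas hmono hT t
    refine MeasurableSet.inter (hT t) (MeasurableSet.iInter fun n => MeasurableSet.compl ?_)
    have hmS := min_meas hmono (stop_cl h2 (s n).2) t
    refine MeasurableSet.inter (stop_cl h2 (s n).2 t) ?_
    let _ := G t
    exact measurableSet_eq_fun hmS hmT
  · intro S hS
    refine measure_mono_null ?_ (hs ⟨S, hS⟩)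
    rintro ω ⟨h3, h4⟩
    simp only [restrictST, mem_ofPred_eq] at h3 h4
    split_ifs at h3 h4 with hc
    · refine ⟨⟨h3, h4⟩, ?_⟩
      simp only [mem_iUnion, mem_ofPred_eq, not_exists, not_and]
      exact fun n hn => absurd hn (hc n)
    · exact absurd h4 (lt_irrefl _)

end decomp
/-- Characterization of `Λ`-measurability of a càdlàg process via its
values at finite `Λ`-stopping times and its jumps at totally `Λ`-inaccessible
stopping times. -/
theorem statement5 (P : Measure Ω) [IsProbabilityMeasure P] [hPc : P.IsComplete]
    (Λ : MeasurableSpace (Ω × ℝ≥0)) (hΛ : IsMeyer mΩ Λ) (hcomp : IsPCompleteM P Λ)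
    (G : ℝ≥0 → MeasurableSpace Ω) (hG : UsualConditions P G)
    (h1 : predSF G ≤ Λ) (h2 : Λ ≤ optSF G)
    (X : Ω × ℝ≥0 → ℝ) (hXm : Measurable X) (hXc : ∀ ω, IsCadlag fun t => X (ω, t)) :
    Measurable[Λ] X ↔
      ((∀ T, IsStoppingTimeM Λ T → (∀ ω, T ω < ∞) →
          Measurable[sigmaAtTime Λ T] (EvalAtF X T)) ∧
        ∀ T, IsStoppingTimeCl G T → IsTotallyInaccessibleM P Λ T →
          ∀ᵐ ω ∂P, T ω < ∞ →
            Tendsto (fun s => X (ω, s)) (𝓝[<] (T ω).toNNReal)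
              (𝓝 (X (ω, (T ω).toNNReal)))) := by
  obtain ⟨hmono, hle, hrc, -⟩ := hG
  constructor
  · intro hX
    refine ⟨fun T _ hfin => eval_meas hX hfin, fun T _ hTin => ?_⟩
    have hXa : Adapted' G X := fun t => (hX.mono h2 le_rfl).comp (measurable_section (G := G) t)
    have hnull : ∀ᵐ ω ∂P, ∀ i j : ℕ,
        ¬ (attT (fun t => X (ω, t)) (dq i) (dq j) = T ω ∧ T ω < ∞) := by
      rw [ae_all_iff]; intro i
      rw [ae_all_iff]; intro j
      have := hTin _ (att_stopM hmono hrc h1 hXc hXa hX (dq i) (dq j))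
      rw [ae_iff]
      simpa only [not_not] using this
    filter_upwards [hnull] with ω hω hfin
    by_contra hj
    obtain ⟨i, j, hij⟩ := jump_cover (hXc ω) hj
    rw [ENNReal.coe_toNNReal hfin.ne] at hij
    exact hω i j ⟨hij, hfin⟩
  · rintro ⟨hev, hjump⟩
    have hconst : ∀ t : ℝ≥0, IsStoppingTimeM Λ (fun _ : Ω => (t : ℝ≥0∞)) := by
      intro t
      have := hΛ.contains_borel (Ici t) measurableSet_Ici
      unfold IsStoppingTimeM
      convert this using 1
      ext p; simp
    have hXa : Adapted' G X := by
      intro t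
      obtain ⟨Z, hZ, h⟩ := exists_eval (fun _ => ENNReal.coe_lt_top)
        (hev _ (hconst t) fun _ => ENNReal.coe_lt_top)
      have he : (fun ω => X (ω, t)) = Z ∘ fun ω => (ω, t) := by
        funext ω
        simpa [EvalAtF] using h ω
      rw [he]
      exact (hZ.mono h2 le_rfl).comp (measurable_section (G := G) t)
    have hdec : ∀ x : ℕ × ℕ, ∃ S : ℕ → Ω → ℝ≥0∞, (∀ n, IsStoppingTimeM Λ (S n)) ∧
        ∀ᵐ ω ∂P, ∀ t : ℝ≥0, attT (fun t => X (ω, t)) (dq x.1) (dq x.2) = (t : ℝ≥0∞) →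
          ¬ Tendsto (fun s => X (ω, s)) (𝓝[<] t) (𝓝 (X (ω, t))) → ∃ n, S n ω = t := by
      intro x
      obtain ⟨S, hS, hcl, hin⟩ := decomp P hmono hle h2
        (att_isStopping hmono hrc hXc hXa (dq x.1) (dq x.2))
      refine ⟨S, hS, ?_⟩
      filter_upwards [hjump _ hcl hin] with ω hω t ht hj
      by_contra hno
      push Not at hno
      apply hj
      have hr : restrictST (fun ω => attT (fun t => X (ω, t)) (dq x.1) (dq x.2))
          {ω | ∀ n, S n ω ≠ attT (fun t => X (ω, t)) (dq x.1) (dq x.2)} ω = t := by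
        unfold restrictST
        have hmem : ω ∈ {ω | ∀ n, S n ω ≠ attT (fun t => X (ω, t)) (dq x.1) (dq x.2)} := by
          intro n
          rw [ht]; exact hno n
        rw [if_pos hmem]
        exact ht
      rw [hr] at hω
      simpa using hω ENNReal.coe_lt_top
    choose S hS hSjump using hdec
    -- countable family of finite stopping times
    let R : (ℕ × ℕ) × ℕ × ℕ → Ω → ℝ≥0∞ := fun x ω => min (S x.1 x.2.1 ω) (x.2.2 : ℝ≥0)
    have hRfin : ∀ x ω, R x ω < ∞ := fun x ω => (min_le_right _ _).trans_lt ENNReal.coe_lt_top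
    have hR : ∀ x, IsStoppingTimeM Λ (R x) := by
      intro x
      have := MeasurableSet.union (hS x.1 x.2.1) (hconst (x.2.2 : ℝ≥0))
      unfold IsStoppingTimeM
      convert this using 1
      ext p
      simp only [R, mem_ofPred_eq, mem_union]
      exact min_le_iff
    let R' : Option ((ℕ × ℕ) × ℕ × ℕ) → Ω → ℝ≥0∞ := fun o =>
      match o with
      | none => fun _ => ((0 : ℝ≥0) : ℝ≥0∞)
      | some x => R x
    have hR'fin : ∀ o ω, R' o ω < ∞ := by
      rintro (_ | x) ω
      · exact ENNReal.coe_lt_top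
      · exact hRfin x ω
    have hR' : ∀ o, IsStoppingTimeM Λ (R' o) := by
      rintro (_ | x)
      · exact hconst 0
      · exact hR x
    obtain ⟨Y, hYm, hY⟩ := exists_left hmono h1 hΛ.contains_borel hXc hXa
    let X' : Ω × ℝ≥0 → ℝ := fun p => if ∃ o, R' o p.1 = (p.2 : ℝ≥0∞) then X p else Y p
    have hX' : Measurable[Λ] X' := by
      intro B hB
      have : X' ⁻¹' B = (⋃ o, ({p : Ω × ℝ≥0 | R' o p.1 = (p.2 : ℝ≥0∞)} ∩ X ⁻¹' B)) ∪
          ((⋃ o, {p : Ω × ℝ≥0 | R' o p.1 = (p.2 : ℝ≥0∞)})ᶜ ∩ Y ⁻¹' B) := by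
        ext p
        simp only [X', mem_preimage, mem_union, mem_iUnion, mem_inter_iff, mem_ofPred_eq,
          mem_compl_iff, exists_and_right]
        by_cases hp : ∃ o, R' o p.1 = (p.2 : ℝ≥0∞)
        · simp [hp]
        · simp [hp]
      rw [this]
      refine MeasurableSet.union (MeasurableSet.iUnion fun o => ?_)
        (MeasurableSet.inter (MeasurableSet.compl (MeasurableSet.iUnion fun o => ?_)) (hYm hB))
      · exact graph_inter_meas hmono h1 h2 (hR' o) (hR'fin o) (hev _ (hR' o) (hR'fin o)) hB
      · exact graph_meas hmono h1 h2 (hR' o)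
    refine hcomp X X' hXm hX' ?_
    have hae : ∀ᵐ ω ∂P, ∀ x : ℕ × ℕ, ∀ t : ℝ≥0,
        attT (fun t => X (ω, t)) (dq x.1) (dq x.2) = (t : ℝ≥0∞) →
        ¬ Tendsto (fun s => X (ω, s)) (𝓝[<] t) (𝓝 (X (ω, t))) → ∃ n, S x n ω = t :=
      ae_all_iff.2 hSjump
    refine measure_mono_null ?_ (ae_iff.1 hae)
    rintro ω ⟨t, ht⟩
    simp only [mem_ofPred_eq]
    intro hall
    apply ht
    by_cases hc : ∃ o, R' o ω = (t : ℝ≥0∞)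
    · simp [X', hc]
    · have hX't : X' (ω, t) = Y (ω, t) := by simp only [X', if_neg hc]
      have htpos : 0 < t := by
        rcases eq_or_ne t 0 with rfl | h
        · exact absurd ⟨none, rfl⟩ hc
        · exact pos_iff_ne_zero.2 h
      rw [hX't]
      by_contra hne
      have hj : ¬ Tendsto (fun s => X (ω, s)) (𝓝[<] t) (𝓝 (X (ω, t))) := by
        intro hten
        have : (𝓝[<] t).NeBot := nhdsLT_neBot_of_exists_lt ⟨0, htpos⟩
        exact hne (tendsto_nhds_unique hten (hY ω t htpos))
      obtain ⟨i, j, hij⟩ := jump_cover (hXc ω) hj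
      obtain ⟨n, hn⟩ := hall (i, j) t hij hj
      obtain ⟨N, hN⟩ := exists_nat_ge t
      apply hc
      refine ⟨some ((i, j), n, N), ?_⟩
      change min (S (i, j) n ω) ((N : ℝ≥0) : ℝ≥0∞) = t
      rw [hn]
      exact min_eq_left (by exact_mod_cast hN)

end Meyer
end
end
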